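/- arXiv:0905.1150 — 8 statements merged into one kernel-verified Lean document; each statement's English description precedes it below -/
import Mathlib

section
/- Let n ≥ 9 be an even integer and D = (d_{ij}) a standardized n×n array. Then there exists a probability space carrying random variables W and W* such that W has the law of Σ_{i=1}^n d_{iπ(i)} with π uniform on Π_n, W* has the W-zero bias distribution, and E|W − W*| ≤ 112 β_D/n + 672 β_D/n² + 192 β_D/n³. -/
open Finset MeasureTheory ProbabilityTheory
open scoped ENNReal

/-- The set of fixed-point-free involutions of `{1,…,n}`. -/
def fpfInvolutions (n : ℕ) : Finset (Equiv.Perm (Fin n)) :=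
  Finset.univ.filter fun π => π * π = 1 ∧ ∀ i, π i ≠ i

namespace InvolutionCLT

section Mixture

variable {A : Type} [Fintype A] [MeasurableSpace A]

/-- The mixture over `a`, with weights `w a`, of the laws of `(a, U)`, where `U` is uniform on
the unit interval. -/
noncomputable def mixture (w : A → ℝ) : Measure (A × ℝ) :=
  ∑ a, ENNReal.ofReal (w a) • (volume.restrict (Set.Ioc (0 : ℝ) 1)).map (Prod.mk a)

theorem isProbabilityMeasure_mixture {w : A → ℝ} (hw : ∀ a, 0 ≤ w a) (hw1 : ∑ a, w a = 1) :
    IsProbabilityMeasure (mixture w) where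
  measure_univ := by
    simp only [mixture, Measure.coe_finsetSum, Measure.coe_smul, Finset.sum_apply,
      Pi.smul_apply, smul_eq_mul]
    simp_rw [Measure.map_apply measurable_prodMk_left MeasurableSet.univ]
    simp [← ENNReal.ofReal_sum_of_nonneg fun a _ => hw a, hw1]

theorem integral_mixture {w : A → ℝ} (hw : ∀ a, 0 ≤ w a) {F : A × ℝ → ℝ} (hF : Measurable F)
    (hint : ∀ a, IntervalIntegrable (fun u => F (a, u)) volume 0 1) :
    ∫ x, F x ∂(mixture w) = ∑ a, w a * ∫ u in (0 : ℝ)..1, F (a, u) := by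
  have hint' : ∀ a, Integrable F ((volume.restrict (Set.Ioc (0 : ℝ) 1)).map (Prod.mk a)) := by
    intro a
    rw [integrable_map_measure hF.aestronglyMeasurable measurable_prodMk_left.aemeasurable]
    exact (intervalIntegrable_iff_integrableOn_Ioc_of_le zero_le_one).1 (hint a)
  rw [mixture, integral_finsetSum_measure fun a _ => (hint' a).smul_measure ENNReal.ofReal_ne_top]
  refine sum_congr rfl fun a _ => ?_
  rw [integral_smul_measure, ENNReal.toReal_ofReal (hw a), smul_eq_mul,
    integral_map measurable_prodMk_left.aemeasurable hF.aestronglyMeasurable,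
    intervalIntegral.integral_of_le zero_le_one]

theorem map_mixture [MeasurableSingletonClass A] (w : A → ℝ) (y : A → ℝ) :
    (mixture w).map (fun x => y x.1) = ∑ a, ENNReal.ofReal (w a) • Measure.dirac (y a) := by
  have hy : Measurable fun x : A × ℝ => y x.1 := (measurable_of_finite y).comp measurable_fst
  ext s hs
  rw [Measure.map_apply hy hs]
  simp only [mixture, Measure.coe_finsetSum, Measure.coe_smul, Finset.sum_apply,
      Pi.smul_apply, smul_eq_mul]
  refine sum_congr rfl fun a _ => ?_
  rw [Measure.map_apply measurable_prodMk_left (hy hs), Measure.dirac_apply' _ hs]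
  by_cases h : y a ∈ s
  · have : Prod.mk a ⁻¹' ((fun x : A × ℝ => y x.1) ⁻¹' s) = Set.univ := by ext; simp [h]
    rw [this]; simp [h]
  · have : Prod.mk a ⁻¹' ((fun x : A × ℝ => y x.1) ⁻¹' s) = ∅ := by ext; simp [h]
    rw [this]; simp [h]

end Mixture

theorem measurable_of_hasDerivAt {f f' : ℝ → ℝ} (hf : ∀ x, HasDerivAt f (f' x) x) :
    Measurable f' := by
  rw [show f' = deriv f from funext fun x => (hf x).deriv.symm]
  exact measurable_deriv f

theorem intervalIntegrable_comp_segment {f f' : ℝ → ℝ} {K : NNReal} (hK : LipschitzWith K f)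
    (hf : ∀ x, HasDerivAt f (f' x) x) (s t : ℝ) :
    IntervalIntegrable (fun u => f' (u * s + (1 - u) * t)) volume 0 1 := by
  refine (intervalIntegrable_const (c := (K : ℝ))).mono_fun
    ((measurable_of_hasDerivAt hf).comp (by fun_prop)).aestronglyMeasurable ?_
  refine Filter.Eventually.of_forall fun u => ?_
  simp only [← (hf _).deriv]
  simpa using norm_deriv_le_of_lipschitz (x₀ := u * s + (1 - u) * t) hK

theorem sub_mul_integral_segment {f f' : ℝ → ℝ} {K : NNReal} (hK : LipschitzWith K f)
    (hf : ∀ x, HasDerivAt f (f' x) x) (s t : ℝ) :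
    (s - t) * ∫ u in (0 : ℝ)..1, f' (u * s + (1 - u) * t) = f s - f t := by
  have h := intervalIntegral.integral_eq_sub_of_hasDerivAt (a := (0 : ℝ)) (b := 1)
    (f := fun u => f (u * s + (1 - u) * t))
    (f' := fun u => (s - t) * f' (u * s + (1 - u) * t)) (fun u _ => ?_)
    ((intervalIntegrable_comp_segment hK hf s t).const_mul _)
  · rw [← intervalIntegral.integral_const_mul, h]; simp
  · have h1 : HasDerivAt (fun u : ℝ => u * s + (1 - u) * t) (s - t) u := by
      have := ((hasDerivAt_id u).mul_const s).add
        (((hasDerivAt_const u (1 : ℝ)).sub (hasDerivAt_id u)).mul_const t)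
      exact this.congr_deriv (by ring)
    have h2 := (hf (u * s + (1 - u) * t)).comp u h1
    exact h2.congr_deriv (mul_comm _ _)

theorem integral_abs_sub_segment_le {y s t c α β : ℝ}
    (h : ∀ u, y - (u * s + (1 - u) * t) = c + (u * α + (1 - u) * β)) :
    ∫ u in (0 : ℝ)..1, |y - (u * s + (1 - u) * t)| ≤ |c| + (|α| + |β|) / 2 := by
  have hle : ∫ u in (0 : ℝ)..1, |y - (u * s + (1 - u) * t)| ≤
      ∫ u in (0 : ℝ)..1, (|c| + |β| + u * (|α| - |β|)) := by
    apply intervalIntegral.integral_mono_on zero_le_one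
    · exact Continuous.intervalIntegrable (by fun_prop) _ _
    · exact Continuous.intervalIntegrable (by fun_prop) _ _
    · rintro u ⟨h0, h1⟩
      rw [h]
      refine (abs_add_le _ _).trans ?_
      have := abs_add_le (u * α) ((1 - u) * β)
      rw [abs_mul, abs_mul, abs_of_nonneg h0, abs_of_nonneg (sub_nonneg.2 h1)] at this
      linarith
  refine hle.trans (le_of_eq ?_)
  rw [intervalIntegral.integral_add (by simp) (Continuous.intervalIntegrable (by fun_prop) _ _),
    intervalIntegral.integral_mul_const, integral_id]
  simp; ring

open Equiv

variable {n : ℕ}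

/-- Conjugation of a permutation by a transposition. -/
def conjSwap (a b : Fin n) (ρ : Perm (Fin n)) : Perm (Fin n) := swap a b * ρ * swap a b

theorem conjSwap_apply (a b : Fin n) (ρ : Perm (Fin n)) (x : Fin n) :
    conjSwap a b ρ x = swap a b (ρ (swap a b x)) := rfl

theorem conjSwap_conjSwap (a b : Fin n) (ρ : Perm (Fin n)) :
    conjSwap a b (conjSwap a b ρ) = ρ := by
  ext x; simp [conjSwap_apply]

theorem mem_fpf {ρ : Perm (Fin n)} :
    ρ ∈ fpfInvolutions n ↔ (∀ i, ρ (ρ i) = i) ∧ ∀ i, ρ i ≠ i := by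
  simp [fpfInvolutions, Equiv.ext_iff]

theorem conjSwap_mem {ρ : Perm (Fin n)} (hρ : ρ ∈ fpfInvolutions n) (a b : Fin n) :
    conjSwap a b ρ ∈ fpfInvolutions n := by
  rw [mem_fpf] at *
  refine ⟨fun i => by simp [conjSwap_apply, hρ.1], fun i h => hρ.2 (swap a b i) ?_⟩
  rw [conjSwap_apply] at h
  simpa using congrArg (swap a b) h

theorem fpfInvolutions_nonempty (hn : Even n) : (fpfInvolutions n).Nonempty := by
  refine ⟨Fin.revPerm, mem_fpf.2 ⟨fun i => by simp, fun i h => ?_⟩⟩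
  have := congrArg Fin.val h
  simp [Fin.val_rev] at this
  obtain ⟨m, rfl⟩ := hn
  omega

/-- The statistic `∑ i, d i (ρ i)`. -/
def stat (d : Fin n → Fin n → ℝ) (ρ : Perm (Fin n)) : ℝ := ∑ i, d i (ρ i)

theorem stat_conjSwap {d : Fin n → Fin n → ℝ} (hsymm : ∀ i j, d i j = d j i)
    {ρ : Perm (Fin n)} (hρ : ρ ∈ fpfInvolutions n) {a b : Fin n} (hab : ρ a ≠ b) :
    stat d (conjSwap a b ρ) =
      stat d ρ + 2 * (d a (ρ b) + d b (ρ a) - d a (ρ a) - d b (ρ b)) := by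
  rw [mem_fpf] at hρ
  by_cases h : a = b
  · subst h; simp [conjSwap, stat]
  have hba : ρ b ≠ a := fun e => hab (by rw [← e, hρ.1])
  have hinj : ρ a ≠ ρ b := fun e => h (ρ.injective e)
  have key : stat d (conjSwap a b ρ) - stat d ρ =
      ∑ i, (d (swap a b i) (swap a b (ρ i)) - d i (ρ i)) := by
    rw [sum_sub_distrib, stat, stat, ← Equiv.sum_comp (swap a b)]
    simp [conjSwap_apply]
  have hsub : ∑ i, (d (swap a b i) (swap a b (ρ i)) - d i (ρ i)) =
      ∑ i ∈ ({a, b, ρ a, ρ b} : Finset (Fin n)),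
        (d (swap a b i) (swap a b (ρ i)) - d i (ρ i)) := by
    symm
    apply sum_subset (subset_univ _)
    intro x _ hx
    simp only [mem_insert, mem_singleton, not_or] at hx
    obtain ⟨h1, h2, h3, h4⟩ := hx
    rw [swap_apply_of_ne_of_ne h1 h2, swap_apply_of_ne_of_ne, sub_self]
    · intro e; exact h3 (by rw [← e, hρ.1])
    · intro e; exact h4 (by rw [← e, hρ.1])
  rw [sum_insert (by simp [h, (hρ.2 a).symm, hba.symm]),
    sum_insert (by simp [hab.symm, (hρ.2 b).symm]), sum_insert (by simp [hinj]),
    sum_singleton] at hsub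
  simp only [swap_apply_left, swap_apply_right, hρ.1,
    swap_apply_of_ne_of_ne (hρ.2 a) hab, swap_apply_of_ne_of_ne hba (hρ.2 b)] at hsub
  rw [hsymm (ρ a) b, hsymm (ρ b) a, hsymm (ρ a) a, hsymm (ρ b) b] at hsub
  linarith

/-- A family of fixed-point-free involutions, each preserving `T`, that is stable under
relabelling of the points outside `T`. -/
structure RelabelInvariant (A : Finset (Perm (Fin n))) (T : Finset (Fin n)) : Prop where
  subset : A ⊆ fpfInvolutions n
  conjSwap_mem : ∀ ρ ∈ A, ∀ x ∉ T, ∀ y ∉ T, conjSwap x y ρ ∈ A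
  apply_notMem : ∀ ρ ∈ A, ∀ x ∉ T, ρ x ∉ T

theorem relabelInvariant_fpf : RelabelInvariant (fpfInvolutions n) ∅ where
  subset := Subset.rfl
  conjSwap_mem _ h _ _ _ _ := InvolutionCLT.conjSwap_mem h _ _
  apply_notMem := by simp

namespace RelabelInvariant

variable {A : Finset (Perm (Fin n))} {T : Finset (Fin n)}

theorem filter (h : RelabelInvariant A T) (j a : Fin n) :
    RelabelInvariant (A.filter fun ρ => ρ j = a) (insert j (insert a T)) where
  subset := (filter_subset _ _).trans h.subset
  conjSwap_mem ρ hρ x hx y hy := by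
    simp only [mem_insert, not_or, mem_filter] at *
    refine ⟨h.conjSwap_mem ρ hρ.1 x hx.2.2 y hy.2.2, ?_⟩
    rw [conjSwap_apply, swap_apply_of_ne_of_ne (Ne.symm hx.1) (Ne.symm hy.1), hρ.2,
      swap_apply_of_ne_of_ne (Ne.symm hx.2.1) (Ne.symm hy.2.1)]
  apply_notMem ρ hρ x hx := by
    simp only [mem_insert, not_or, mem_filter] at *
    have hi := (mem_fpf.1 (h.subset hρ.1)).1
    refine ⟨fun e => hx.2.1 ?_, fun e => hx.1 ?_, h.apply_notMem ρ hρ.1 x hx.2.2⟩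
    · rw [← hρ.2, ← e, hi]
    · exact ρ.injective (e.trans hρ.2.symm)

theorem sum_fiberwise (h : RelabelInvariant A T) {j : Fin n} (hj : j ∉ T)
    (g : Perm (Fin n) → ℝ) :
    ∑ ρ ∈ A, g ρ = ∑ a ∈ (insert j T)ᶜ, ∑ ρ ∈ A with ρ j = a, g ρ := by
  rw [Finset.sum_fiberwise_of_maps_to]
  intro ρ hρ
  simp [(mem_fpf.1 (h.subset hρ)).2 j, h.apply_notMem ρ hρ j hj]

theorem card_compl_insert {j : Fin n} (hj : j ∉ T) :
    (((insert j T)ᶜ.card : ℕ) : ℝ) = (n : ℝ) - T.card - 1 := by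
  have h1 := card_add_card_compl (insert j T)
  rw [card_insert_of_notMem hj, Fintype.card_fin] at h1
  have : ((T.card : ℝ) + 1) + (insert j T)ᶜ.card = n := by exact_mod_cast h1
  linarith

theorem sum_conjSwap (h : RelabelInvariant A T) {j l : Fin n} (hj : j ∉ T) (hl : l ∉ T)
    (hjl : j ≠ l) (g : Perm (Fin n) → ℝ) :
    ∑ ρ ∈ A, g (conjSwap (ρ j) l ρ) =
      ((n : ℝ) - T.card - 1) * ∑ ρ ∈ A with ρ j = l, g ρ := by
  rw [h.sum_fiberwise hj, ← card_compl_insert hj, ← nsmul_eq_mul, ← sum_const]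
  refine sum_congr rfl fun a ha => ?_
  simp only [mem_compl, mem_insert, not_or] at ha
  refine sum_nbij' (conjSwap a l) (conjSwap a l) ?_ ?_ ?_ ?_ ?_
  · intro ρ hρ
    simp only [mem_filter] at *
    refine ⟨h.conjSwap_mem ρ hρ.1 a ha.2 l hl, ?_⟩
    rw [conjSwap_apply, swap_apply_of_ne_of_ne (Ne.symm ha.1) hjl, hρ.2, swap_apply_left]
  · intro ρ hρ
    simp only [mem_filter] at *
    refine ⟨h.conjSwap_mem ρ hρ.1 a ha.2 l hl, ?_⟩
    rw [conjSwap_apply, swap_apply_of_ne_of_ne (Ne.symm ha.1) hjl, hρ.2, swap_apply_right]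
  · intro ρ _; exact conjSwap_conjSwap _ _ _
  · intro ρ _; exact conjSwap_conjSwap _ _ _
  · intro ρ hρ
    rw [(mem_filter.1 hρ).2]

theorem card_eq (h : RelabelInvariant A T) {j l : Fin n} (hj : j ∉ T) (hl : l ∉ T)
    (hjl : j ≠ l) :
    (A.card : ℝ) = ((n : ℝ) - T.card - 1) * (A.filter fun ρ => ρ j = l).card := by
  simpa using h.sum_conjSwap hj hl hjl fun _ => 1

theorem sum_apply_le (h : RelabelInvariant A T) {j : Fin n} (hj : j ∉ T)
    (ht : 0 < (n : ℝ) - T.card - 1) {g : Fin n → ℝ} (hg : ∀ a, 0 ≤ g a) :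
    ∑ ρ ∈ A, g (ρ j) ≤ A.card / ((n : ℝ) - T.card - 1) * ∑ a, g a := by
  rw [h.sum_fiberwise hj, mul_sum]
  refine le_trans (sum_le_sum fun a ha => ?_) (sum_le_sum_of_subset_of_nonneg
    (subset_univ (insert j T)ᶜ) fun a _ _ => mul_nonneg (by positivity) (hg a))
  simp only [mem_compl, mem_insert, not_or] at ha
  rw [h.card_eq hj ha.2 (Ne.symm ha.1), mul_div_cancel_left₀ _ ht.ne']
  rw [sum_congr rfl fun ρ hρ => by rw [(mem_filter.1 hρ).2]]
  simp

theorem sum_apply_apply_le (h : RelabelInvariant A T) {j l : Fin n} (hj : j ∉ T) (hl : l ∉ T)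
    (hjl : j ≠ l) (ht : 0 < (n : ℝ) - T.card - 3) {g : Fin n → Fin n → ℝ}
    (hg : ∀ a b, 0 ≤ g a b) :
    ∑ ρ ∈ A, g (ρ j) (ρ l) ≤ A.card / ((n : ℝ) - T.card - 1) *
      (g l j + (∑ a, ∑ b, g a b) / ((n : ℝ) - T.card - 3)) := by
  have ht1 : 0 < (n : ℝ) - T.card - 1 := by linarith
  set c : ℝ := A.card / ((n : ℝ) - T.card - 1) with hc
  have hcard : ∀ a ∉ T, j ≠ a → ((A.filter fun ρ => ρ j = a).card : ℝ) = c := fun a ha hja => by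
    rw [hc, h.card_eq hj ha hja, mul_div_cancel_left₀ _ ht1.ne']
  have hc0 : 0 ≤ c := by positivity
  have hlm : l ∈ (insert j T)ᶜ := by simp [hl, hjl.symm]
  rw [h.sum_fiberwise hj, ← add_sum_erase _ _ hlm, mul_add]
  refine add_le_add ?_ ?_
  · rw [← hcard l hl hjl, ← nsmul_eq_mul, ← sum_const]
    refine (sum_congr rfl fun ρ hρ => ?_).le
    obtain ⟨h1, h2⟩ := mem_filter.1 hρ
    have hi := (mem_fpf.1 (h.subset h1)).1
    rw [h2, ← h2, hi]
  · rw [sum_div, mul_sum]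
    refine le_trans (sum_le_sum fun a ha => ?_) (sum_le_sum_of_subset_of_nonneg
      (subset_univ ((insert j T)ᶜ.erase l)) fun a _ _ =>
        mul_nonneg hc0 (div_nonneg (sum_nonneg fun b _ => hg a b) ht.le))
    simp only [mem_erase, mem_compl, mem_insert, not_or] at ha
    obtain ⟨hal, haj, haT⟩ := ha
    have hcard' : ((insert j (insert a T)).card : ℝ) = T.card + 2 := by
      rw [card_insert_of_notMem (by simp [hj, Ne.symm haj]), card_insert_of_notMem haT]
      push_cast; ring
    have := (h.filter j a).sum_apply_le (j := l) (g := g a)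
      (by simp [hl, hjl.symm, Ne.symm hal]) (by rw [hcard']; linarith) (hg a)
    rw [hcard', hcard a haT (Ne.symm haj)] at this
    rw [sum_congr rfl fun ρ hρ => by rw [(mem_filter.1 hρ).2]]
    refine this.trans (le_of_eq ?_)
    rw [show (n : ℝ) - (T.card + 2) - 1 = n - T.card - 3 by ring]
    ring

end RelabelInvariant

/-- Ordered quadruples of pairwise distinct indices. -/
def distinctQuads (n : ℕ) : Finset (Fin n × Fin n × Fin n × Fin n) :=
  univ.filter fun (i, j, k, l) => i ≠ j ∧ i ≠ k ∧ i ≠ l ∧ j ≠ k ∧ j ≠ l ∧ k ≠ l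

theorem mem_distinctQuads {i j k l : Fin n} : (i, j, k, l) ∈ distinctQuads n ↔
    i ≠ j ∧ i ≠ k ∧ i ≠ l ∧ j ≠ k ∧ j ≠ l ∧ k ≠ l := by
  simp [distinctQuads]

/-- The change in weight when the pairs `{i, l}`, `{j, k}` are replaced by `{i, k}`, `{j, l}`. -/
def contrast (d : Fin n → Fin n → ℝ) (i j k l : Fin n) : ℝ := d i k + d j l - d i l - d j k

theorem sum_compl_pair {i j : Fin n} (hij : i ≠ j) (x : Fin n → ℝ) :
    ∑ k ∈ ({i, j} : Finset (Fin n))ᶜ, x k = ∑ k, x k - x i - x j := by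
  have := sum_add_sum_compl ({i, j} : Finset (Fin n)) x
  rw [sum_pair hij] at this
  linarith

theorem card_compl_pair {i j : Fin n} (hij : i ≠ j) :
    (((({i, j} : Finset (Fin n))ᶜ).card : ℕ) : ℝ) = (n : ℝ) - 2 := by
  have := sum_compl_pair hij fun _ => 1
  simp only [sum_const, nsmul_eq_mul, mul_one, card_univ, Fintype.card_fin] at this
  linarith

theorem sum_sum_sub_sq (C : Finset (Fin n)) (x : Fin n → ℝ) :
    ∑ k ∈ C, ∑ l ∈ C, (x k - x l) ^ 2 =
      2 * C.card * ∑ k ∈ C, x k ^ 2 - 2 * (∑ k ∈ C, x k) ^ 2 := by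
  simp_rw [sub_sq, sum_add_distrib, sum_sub_distrib, ← mul_sum, ← sum_mul, sum_const,
    nsmul_eq_mul, ← mul_sum]
  ring

section Standardized

variable {d : Fin n → Fin n → ℝ}

theorem sum_contrast_sq (hsymm : ∀ i j, d i j = d j i) (hdiag : ∀ i, d i i = 0)
    (hrow : ∀ i, ∑ j, d i j = 0) :
    ∑ q ∈ distinctQuads n, contrast d q.1 q.2.1 q.2.2.1 q.2.2.2 ^ 2 =
      4 * ((n : ℝ) - 1) * ((n : ℝ) - 2) * ∑ i, ∑ j, d i j ^ 2 := by
  have h1 : ∑ q ∈ distinctQuads n, contrast d q.1 q.2.1 q.2.2.1 q.2.2.2 ^ 2 =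
      ∑ i, ∑ j, ∑ k ∈ ({i, j} : Finset (Fin n))ᶜ, ∑ l ∈ ({i, j} : Finset (Fin n))ᶜ,
        ((d i k - d j k) - (d i l - d j l)) ^ 2 := by
    rw [distinctQuads, sum_filter]
    simp only [Fintype.sum_prod_type]
    refine sum_congr rfl fun i _ => sum_congr rfl fun j _ => ?_
    have hC : ∀ x : Fin n → ℝ, ∑ k ∈ ({i, j} : Finset (Fin n))ᶜ, x k =
        ∑ k, if k ∈ ({i, j} : Finset (Fin n))ᶜ then x k else 0 := fun x => by
      rw [sum_ite_mem, univ_inter]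
    simp_rw [hC]
    refine sum_congr rfl fun k _ => ?_
    split_ifs with hk
    · refine sum_congr rfl fun l _ => ?_
      simp only [mem_compl, mem_insert, mem_singleton, not_or] at hk ⊢
      by_cases hij : i = j
      · simp [hij]
      by_cases hkl : k = l
      · simp [hkl]
      by_cases hl : l = i ∨ l = j
      · rw [if_neg (by tauto), if_neg (by tauto)]
      · rw [if_pos (by simp only [ne_eq, eq_comm] at *; tauto), if_pos (by tauto), contrast]
        ring
    · refine sum_eq_zero fun l _ => if_neg ?_
      simp only [mem_compl, mem_insert, mem_singleton, not_or] at hk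
      simp only [ne_eq, eq_comm] at *; tauto
  have h2 : ∀ i j, ∑ k ∈ ({i, j} : Finset (Fin n))ᶜ, ∑ l ∈ ({i, j} : Finset (Fin n))ᶜ,
        ((d i k - d j k) - (d i l - d j l)) ^ 2 =
      2 * ((n : ℝ) - 2) * (∑ k, (d i k - d j k) ^ 2 - 2 * d i j ^ 2) := by
    intro i j
    by_cases hij : i = j
    · subst hij; simp [hdiag]
    rw [sum_sum_sub_sq, card_compl_pair hij, sum_compl_pair hij, sum_compl_pair hij,
      sum_sub_distrib, hrow, hrow, hdiag, hdiag, hsymm j i]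
    ring
  have h3 : ∀ i j, ∑ k, (d i k - d j k) ^ 2 =
      ∑ k, d i k ^ 2 - 2 * ∑ k, d i k * d j k + ∑ k, d j k ^ 2 := by
    intro i j
    rw [mul_sum, ← sum_sub_distrib, ← sum_add_distrib]
    exact sum_congr rfl fun k _ => by ring
  have h4 : ∀ i, ∑ j, ∑ k, d i k * d j k = 0 := by
    intro i
    rw [sum_comm]
    refine sum_eq_zero fun k _ => ?_
    rw [← mul_sum]
    simp_rw [hsymm _ k, hrow]; simp
  rw [h1]
  simp_rw [h2, h3, ← mul_sum, sum_sub_distrib, sum_add_distrib, sum_sub_distrib, ← mul_sum, h4]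
  simp only [sum_const, card_univ, Fintype.card_fin, nsmul_eq_mul, ← mul_sum]
  ring

theorem sum_contrast_apply (hsymm : ∀ i j, d i j = d j i) (hdiag : ∀ i, d i i = 0)
    (hrow : ∀ i, ∑ j, d i j = 0) {ρ : Perm (Fin n)} (hρ : ρ ∈ fpfInvolutions n) :
    ∑ i, ∑ j ∈ ({i, ρ i} : Finset (Fin n))ᶜ, contrast d i j (ρ i) (ρ j) =
      2 * ((n : ℝ) - 1) * stat d ρ := by
  have h1 : ∀ i, ∑ j ∈ ({i, ρ i} : Finset (Fin n))ᶜ, contrast d i j (ρ i) (ρ j) =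
      ((n : ℝ) - 2) * d i (ρ i) + stat d ρ := by
    intro i
    rw [sum_compl_pair ((mem_fpf.1 hρ).2 i).symm]
    simp only [contrast, sum_sub_distrib, sum_add_distrib, (mem_fpf.1 hρ).1, hdiag,
      hsymm (ρ i) i]
    rw [Equiv.sum_comp ρ (d i), hrow]
    simp_rw [hsymm _ (ρ i), hrow]
    simp [stat]; ring
  simp_rw [h1, sum_add_distrib, ← mul_sum]
  simp [stat]; ring

end Standardized

/-- The fixed-point-free involutions containing the pairs `{i, k}` and `{j, l}`. -/
def pairFiber (i j k l : Fin n) : Finset (Perm (Fin n)) :=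
  ((fpfInvolutions n).filter fun ρ => ρ i = k).filter fun ρ => ρ j = l

theorem mem_pairFiber {i j k l : Fin n} {ρ : Perm (Fin n)} :
    ρ ∈ pairFiber i j k l ↔ (ρ ∈ fpfInvolutions n ∧ ρ i = k) ∧ ρ j = l := by
  simp [pairFiber]

theorem sum_pairFiber_conjSwap {i j k l : Fin n} (hq : (i, j, k, l) ∈ distinctQuads n)
    (g : Perm (Fin n) → ℝ) :
    ∑ ρ ∈ pairFiber i j k l, g (conjSwap i j ρ) = ∑ ρ ∈ pairFiber i j l k, g ρ := by
  obtain ⟨-, hik, hil, hjk, hjl, -⟩ := mem_distinctQuads.1 hq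
  refine sum_nbij' (conjSwap i j) (conjSwap i j) ?_ ?_ ?_ ?_ fun _ _ => rfl
  · intro ρ hρ
    simp only [mem_pairFiber] at *
    refine ⟨⟨conjSwap_mem hρ.1.1 _ _, ?_⟩, ?_⟩
    · rw [conjSwap_apply, swap_apply_left, hρ.2, swap_apply_of_ne_of_ne hil.symm hjl.symm]
    · rw [conjSwap_apply, swap_apply_right, hρ.1.2, swap_apply_of_ne_of_ne hik.symm hjk.symm]
  · intro ρ hρ
    simp only [mem_pairFiber] at *
    refine ⟨⟨conjSwap_mem hρ.1.1 _ _, ?_⟩, ?_⟩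
    · rw [conjSwap_apply, swap_apply_left, hρ.2, swap_apply_of_ne_of_ne hik.symm hjk.symm]
    · rw [conjSwap_apply, swap_apply_right, hρ.1.2, swap_apply_of_ne_of_ne hil.symm hjl.symm]
  · intro ρ _; exact conjSwap_conjSwap _ _ _
  · intro ρ _; exact conjSwap_conjSwap _ _ _

theorem sum_distinctQuads_swap_right (F : Fin n → Fin n → Fin n → Fin n → ℝ) :
    ∑ q ∈ distinctQuads n, F q.1 q.2.1 q.2.2.2 q.2.2.1 =
      ∑ q ∈ distinctQuads n, F q.1 q.2.1 q.2.2.1 q.2.2.2 := by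
  refine sum_nbij' (fun q => (q.1, q.2.1, q.2.2.2, q.2.2.1))
    (fun q => (q.1, q.2.1, q.2.2.2, q.2.2.1)) ?_ ?_ (fun _ _ => rfl) (fun _ _ => rfl)
    (fun _ _ => rfl) <;>
  · rintro ⟨i, j, k, l⟩ h
    rw [mem_distinctQuads] at *
    simp only [ne_eq, eq_comm] at *; tauto

theorem sum_distinctQuads_swap_left (F : Fin n → Fin n → Fin n → Fin n → ℝ) :
    ∑ q ∈ distinctQuads n, F q.2.1 q.1 q.2.2.1 q.2.2.2 =
      ∑ q ∈ distinctQuads n, F q.1 q.2.1 q.2.2.1 q.2.2.2 := by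
  refine sum_nbij' (fun q => (q.2.1, q.1, q.2.2.1, q.2.2.2))
    (fun q => (q.2.1, q.1, q.2.2.1, q.2.2.2)) ?_ ?_ (fun _ _ => rfl) (fun _ _ => rfl)
    (fun _ _ => rfl) <;>
  · rintro ⟨i, j, k, l⟩ h
    rw [mem_distinctQuads] at *
    simp only [ne_eq, eq_comm] at *; tauto

theorem sum_distinctQuads_sum_pairFiber
    (G : Fin n → Fin n → Fin n → Fin n → Perm (Fin n) → ℝ) :
    ∑ q ∈ distinctQuads n, ∑ ρ ∈ pairFiber q.1 q.2.1 q.2.2.1 q.2.2.2,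
        G q.1 q.2.1 q.2.2.1 q.2.2.2 ρ =
      ∑ ρ ∈ fpfInvolutions n, ∑ i, ∑ j ∈ ({i, ρ i} : Finset (Fin n))ᶜ,
        G i j (ρ i) (ρ j) ρ := by
  rw [sum_comm' (s' := fun ρ => (distinctQuads n).filter
    fun q => ρ q.1 = q.2.2.1 ∧ ρ q.2.1 = q.2.2.2) (t' := fpfInvolutions n)]
  · refine sum_congr rfl fun ρ hρ => ?_
    rw [mem_fpf] at hρ
    rw [sum_sigma']
    refine sum_nbij' (fun q => ⟨q.1, q.2.1⟩) (fun p => (p.1, p.2, ρ p.1, ρ p.2)) ?_ ?_ ?_ ?_ ?_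
    · rintro ⟨i, j, k, l⟩ h
      rw [mem_filter, mem_distinctQuads] at h
      dsimp only at h
      obtain ⟨h, rfl, rfl⟩ := h
      simp [h.1.symm, h.2.2.2.1]
    · rintro ⟨i, j⟩ h
      simp only [mem_sigma, mem_univ, mem_compl, mem_insert, mem_singleton, true_and,
        not_or] at h
      rw [mem_filter, mem_distinctQuads]
      refine ⟨⟨Ne.symm h.1, (hρ.2 i).symm, fun e => h.2 ?_, h.2, (hρ.2 j).symm,
        fun e => h.1 (ρ.injective e).symm⟩, rfl, rfl⟩
      change i = ρ j at e
      rw [e, hρ.1]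
    · rintro ⟨i, j, k, l⟩ h
      rw [mem_filter] at h
      dsimp only at h
      obtain ⟨h, rfl, rfl⟩ := h
      rfl
    · rintro ⟨i, j⟩ h; rfl
    · rintro ⟨i, j, k, l⟩ h
      rw [mem_filter] at h
      dsimp only at h
      obtain ⟨h, rfl, rfl⟩ := h
      rfl
  · intro q ρ
    rw [mem_filter, mem_pairFiber]
    tauto

theorem sum_contrast_mul_sum_pairFiber {d : Fin n → Fin n → ℝ}
    (hsymm : ∀ i j, d i j = d j i) (hdiag : ∀ i, d i i = 0) (hrow : ∀ i, ∑ j, d i j = 0)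
    (f : ℝ → ℝ) :
    ∑ q ∈ distinctQuads n, contrast d q.1 q.2.1 q.2.2.1 q.2.2.2 *
        ∑ ρ ∈ pairFiber q.1 q.2.1 q.2.2.1 q.2.2.2,
          (f (stat d ρ) - f (stat d (conjSwap q.1 q.2.1 ρ))) =
      4 * ((n : ℝ) - 1) * ∑ ρ ∈ fpfInvolutions n, stat d ρ * f (stat d ρ) := by
  have h1 : ∑ q ∈ distinctQuads n, contrast d q.1 q.2.1 q.2.2.1 q.2.2.2 *
        ∑ ρ ∈ pairFiber q.1 q.2.1 q.2.2.1 q.2.2.2, f (stat d ρ) =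
      2 * ((n : ℝ) - 1) * ∑ ρ ∈ fpfInvolutions n, stat d ρ * f (stat d ρ) := by
    simp_rw [mul_sum]
    rw [sum_distinctQuads_sum_pairFiber fun i j k l ρ => contrast d i j k l * f (stat d ρ)]
    refine sum_congr rfl fun ρ hρ => ?_
    simp_rw [← sum_mul]
    rw [sum_contrast_apply hsymm hdiag hrow hρ]
    ring
  have h2 : ∑ q ∈ distinctQuads n, contrast d q.1 q.2.1 q.2.2.1 q.2.2.2 *
        ∑ ρ ∈ pairFiber q.1 q.2.1 q.2.2.1 q.2.2.2, f (stat d (conjSwap q.1 q.2.1 ρ)) =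
      - ∑ q ∈ distinctQuads n, contrast d q.1 q.2.1 q.2.2.1 q.2.2.2 *
        ∑ ρ ∈ pairFiber q.1 q.2.1 q.2.2.1 q.2.2.2, f (stat d ρ) := by
    rw [← sum_distinctQuads_swap_right fun i j k l =>
      contrast d i j k l * ∑ ρ ∈ pairFiber i j k l, f (stat d ρ), ← sum_neg_distrib]
    refine sum_congr rfl fun q hq => ?_
    rw [sum_pairFiber_conjSwap hq fun ρ => f (stat d ρ), contrast, contrast]
    ring
  simp_rw [sum_sub_distrib, mul_sub, sum_sub_distrib]
  rw [h2, h1]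
  ring

theorem sum_distinctQuads_fst_le {g : Fin n → Fin n → ℝ} (hg : ∀ i k, 0 ≤ g i k)
    (hn : 3 ≤ n) :
    ∑ q ∈ distinctQuads n, g q.1 q.2.2.1 ≤
      ((n : ℝ) - 2) * ((n : ℝ) - 3) * ∑ i, ∑ k, g i k := by
  have h1 : ∑ q ∈ distinctQuads n, g q.1 q.2.2.1 =
      ∑ i, ∑ k ∈ ({i} : Finset (Fin n))ᶜ,
        ∑ _p ∈ (({i, k} : Finset (Fin n))ᶜ).offDiag, g i k := by
    simp_rw [sum_sigma']
    refine sum_nbij' (fun q => ⟨q.1, q.2.2.1, (q.2.1, q.2.2.2)⟩)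
      (fun p => (p.1, p.2.2.1, p.2.1, p.2.2.2)) ?_ ?_ (fun _ _ => rfl) (fun _ _ => rfl)
      (fun _ _ => rfl)
    · rintro ⟨i, j, k, l⟩ h
      rw [mem_distinctQuads] at h
      simp only [mem_sigma, mem_univ, mem_compl, mem_insert, mem_singleton, mem_offDiag]
      simp only [ne_eq, eq_comm] at *; tauto
    · rintro ⟨i, k, j, l⟩ h
      rw [mem_distinctQuads]
      simp only [mem_sigma, mem_univ, mem_compl, mem_insert, mem_singleton, mem_offDiag] at h
      simp only [ne_eq, eq_comm] at *; tauto
  rw [h1, mul_sum]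
  have hn' : (3 : ℝ) ≤ n := by exact_mod_cast hn
  have hc : 0 ≤ ((n : ℝ) - 2) * ((n : ℝ) - 3) := mul_nonneg (by linarith) (by linarith)
  refine sum_le_sum fun i _ => ?_
  rw [mul_sum]
  refine le_trans (sum_le_sum fun k hk => ?_) (sum_le_sum_of_subset_of_nonneg
    (subset_univ ({i}ᶜ)) fun k _ _ => mul_nonneg hc (hg i k))
  rw [mem_compl, mem_singleton] at hk
  rw [sum_const, nsmul_eq_mul, offDiag_card, Nat.cast_sub (Nat.le_mul_self _), Nat.cast_mul,
    card_compl_pair (Ne.symm hk)]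
  exact le_of_eq (by ring)

section Moments

variable {d : Fin n → Fin n → ℝ}

theorem sq_mul_le {x y : ℝ} (hx : 0 ≤ x) (hy : 0 ≤ y) : x ^ 2 * y ≤ (2 * x ^ 3 + y ^ 3) / 3 := by
  nlinarith [mul_nonneg (add_nonneg (add_nonneg hx hx) hy) (sq_nonneg (x - y))]

theorem contrast_sq_mul_le (d : Fin n → Fin n → ℝ) (i j k l : Fin n) {x : ℝ} (hx : 0 ≤ x) :
    contrast d i j k l ^ 2 * x ≤
      8 / 3 * (|d i k| ^ 3 + |d j l| ^ 3 + |d i l| ^ 3 + |d j k| ^ 3) + 16 / 3 * x ^ 3 := by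
  have h : contrast d i j k l ^ 2 ≤
      4 * (|d i k| ^ 2 + |d j l| ^ 2 + |d i l| ^ 2 + |d j k| ^ 2) := by
    simp only [sq_abs, contrast]
    nlinarith [sq_nonneg (d i k - d j l), sq_nonneg (d i k + d i l), sq_nonneg (d i k + d j k),
      sq_nonneg (d j l + d i l), sq_nonneg (d j l + d j k), sq_nonneg (d i l - d j k)]
  have := mul_le_mul_of_nonneg_right h hx
  linarith [sq_mul_le (abs_nonneg (d i k)) hx, sq_mul_le (abs_nonneg (d j l)) hx,
    sq_mul_le (abs_nonneg (d i l)) hx, sq_mul_le (abs_nonneg (d j k)) hx]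

theorem sum_contrast_sq_mul_le (hn : 3 ≤ n) {x : Fin n × Fin n × Fin n × Fin n → ℝ}
    (hx : ∀ q, 0 ≤ x q) :
    ∑ q ∈ distinctQuads n, contrast d q.1 q.2.1 q.2.2.1 q.2.2.2 ^ 2 * x q ≤
      32 / 3 * (((n : ℝ) - 2) * ((n : ℝ) - 3) * ∑ i, ∑ j, |d i j| ^ 3) +
        16 / 3 * ∑ q ∈ distinctQuads n, x q ^ 3 := by
  have hm : ∑ q ∈ distinctQuads n, |d q.1 q.2.2.1| ^ 3 ≤
      ((n : ℝ) - 2) * ((n : ℝ) - 3) * ∑ i, ∑ j, |d i j| ^ 3 :=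
    sum_distinctQuads_fst_le (g := fun i k => |d i k| ^ 3) (fun i k => by positivity) hn
  have e1 : ∑ q ∈ distinctQuads n, |d q.1 q.2.2.2| ^ 3 = ∑ q ∈ distinctQuads n,
    |d q.1 q.2.2.1| ^ 3 := sum_distinctQuads_swap_right fun i _ k _ => |d i k| ^ 3
  have e2 : ∑ q ∈ distinctQuads n, |d q.2.1 q.2.2.1| ^ 3 = ∑ q ∈ distinctQuads n,
    |d q.1 q.2.2.1| ^ 3 := sum_distinctQuads_swap_left fun i _ k _ => |d i k| ^ 3
  have e3 : ∑ q ∈ distinctQuads n, |d q.2.1 q.2.2.2| ^ 3 = ∑ q ∈ distinctQuads n,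
    |d q.2.1 q.2.2.1| ^ 3 := sum_distinctQuads_swap_right fun _ j k _ => |d j k| ^ 3
  refine (sum_le_sum fun q _ => contrast_sq_mul_le d q.1 q.2.1 q.2.2.1 q.2.2.2 (hx q)).trans ?_
  simp only [sum_add_distrib, ← mul_sum]
  rw [e3, e1, e2]
  linarith

end Moments

/-- Relabel `ρ` by a transposition so that `i` becomes paired with `k`. -/
def forcePair (i k : Fin n) (ρ : Perm (Fin n)) : Perm (Fin n) := conjSwap (ρ i) k ρ

theorem forcePair_mem {ρ : Perm (Fin n)} (hρ : ρ ∈ fpfInvolutions n) (i k : Fin n) :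
    forcePair i k ρ ∈ fpfInvolutions n := conjSwap_mem hρ _ _

theorem forcePair_apply {ρ : Perm (Fin n)} (hρ : ρ ∈ fpfInvolutions n) {i k : Fin n}
    (hik : i ≠ k) : forcePair i k ρ i = k := by
  rw [forcePair, conjSwap_apply, swap_apply_of_ne_of_ne ((mem_fpf.1 hρ).2 i).symm hik,
    swap_apply_left]

theorem forcePair_apply_of_apply_eq {ρ : Perm (Fin n)} (hρ : ρ ∈ fpfInvolutions n)
    {i j k l : Fin n} (hq : (i, j, k, l) ∈ distinctQuads n) (hi : ρ i = k) :
    forcePair j l ρ i = k := by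
  obtain ⟨hij, hik, hil, hjk, hjl, hkl⟩ := mem_distinctQuads.1 hq
  have h1 : i ≠ ρ j := fun e => hjk (by rw [← hi, e, (mem_fpf.1 hρ).1])
  have h2 : k ≠ ρ j := fun e => hij (ρ.injective (hi.trans e))
  rw [forcePair, conjSwap_apply, swap_apply_of_ne_of_ne h1 hil, hi,
    swap_apply_of_ne_of_ne h2 hkl]

theorem stat_forcePair {d : Fin n → Fin n → ℝ} (hsymm : ∀ i j, d i j = d j i)
    {ρ : Perm (Fin n)} (hρ : ρ ∈ fpfInvolutions n) {i k : Fin n} (hik : i ≠ k) :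
    stat d (forcePair i k ρ) =
      stat d ρ + 2 * (d (ρ i) (ρ k) + d k i - d (ρ i) i - d k (ρ k)) := by
  rw [forcePair, stat_conjSwap hsymm hρ (by rwa [(mem_fpf.1 hρ).1]), (mem_fpf.1 hρ).1]

theorem relabelInvariant_filter (i k : Fin n) :
    RelabelInvariant ((fpfInvolutions n).filter fun ρ => ρ i = k) {i, k} :=
  relabelInvariant_fpf.filter i k

theorem sum_forcePair {i k : Fin n} (hik : i ≠ k) (g : Perm (Fin n) → ℝ) :
    ∑ ρ ∈ fpfInvolutions n, g (forcePair i k ρ) =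
      ((n : ℝ) - 1) * ∑ ρ ∈ fpfInvolutions n with ρ i = k, g ρ := by
  simpa [forcePair] using relabelInvariant_fpf.sum_conjSwap (notMem_empty i) (notMem_empty k) hik g

theorem sum_forcePair_forcePair {i j k l : Fin n} (hq : (i, j, k, l) ∈ distinctQuads n)
    (g : Perm (Fin n) → ℝ) :
    ∑ ρ ∈ fpfInvolutions n, g (forcePair j l (forcePair i k ρ)) =
      ((n : ℝ) - 1) * ((n : ℝ) - 3) * ∑ ρ ∈ pairFiber i j k l, g ρ := by
  obtain ⟨hij, hik, hil, hjk, hjl, hkl⟩ := mem_distinctQuads.1 hq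
  rw [sum_forcePair hik fun ρ => g (forcePair j l ρ)]
  have := (relabelInvariant_filter i k).sum_conjSwap (j := j) (l := l)
    (by simp [hij.symm, hjk]) (by simp [hil.symm, hkl.symm]) hjl g
  rw [card_pair hik] at this
  simp only [forcePair]
  rw [this, pairFiber]
  push_cast; ring

section Coupling

variable {d : Fin n → Fin n → ℝ}

/-- The `i`-th row sum of absolute values. -/
def absRow (d : Fin n → Fin n → ℝ) (i : Fin n) : ℝ := ∑ a, |d i a|

/-- A bound for the mean distance, given the quadruple `(i, j, k, l)`, between `W` and `W*`. -/
noncomputable def distBound (d : Fin n → Fin n → ℝ) (i j k l : Fin n) : ℝ :=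
  2 * ((|d i k| + (∑ a, absRow d a) / ((n : ℝ) - 3) + absRow d i + absRow d k) / ((n : ℝ) - 1) +
    (|d j l| + (∑ a, absRow d a) / ((n : ℝ) - 5) + absRow d j + absRow d l) / ((n : ℝ) - 3)) +
    (|d i k| + |d j l| + |d i l| + |d j k|)

/-- The total weight of the pairs created or removed outside of `{i, k}` by `forcePair i k`. -/
def editCost (d : Fin n → Fin n → ℝ) (i k : Fin n) (ρ : Perm (Fin n)) : ℝ :=
  |d (ρ i) (ρ k)| + |d (ρ i) i| + |d k (ρ k)|

theorem sum_editCost_le (hsymm : ∀ i j, d i j = d j i) {A : Finset (Perm (Fin n))}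
    {T : Finset (Fin n)} (h : RelabelInvariant A T) {i k : Fin n} (hi : i ∉ T) (hk : k ∉ T)
    (hik : i ≠ k) (ht : 0 < (n : ℝ) - T.card - 3) :
    ∑ ρ ∈ A, editCost d i k ρ ≤ A.card / ((n : ℝ) - T.card - 1) *
      (|d i k| + (∑ a, absRow d a) / ((n : ℝ) - T.card - 3) + absRow d i + absRow d k) := by
  have h1 := h.sum_apply_apply_le hi hk hik ht (g := fun a b => |d a b|)
    fun a b => abs_nonneg _
  have h2 := h.sum_apply_le hi (by linarith) (g := fun a => |d a i|) fun a => abs_nonneg _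
  have h3 := h.sum_apply_le hk (by linarith) (g := fun a => |d k a|) fun a => abs_nonneg _
  simp only [hsymm _ i] at h2
  rw [hsymm k i] at h1
  simp only [editCost, sum_add_distrib, hsymm _ i]
  simp only [absRow]
  linarith

theorem stat_conjSwap_forcePair (hsymm : ∀ i j, d i j = d j i) {i j k l : Fin n}
    (hq : (i, j, k, l) ∈ distinctQuads n) {π : Perm (Fin n)} (hπ : π ∈ fpfInvolutions n) :
    stat d (conjSwap i j (forcePair j l (forcePair i k π))) =
      stat d (forcePair j l (forcePair i k π)) - 2 * contrast d i j k l := by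
  obtain ⟨hij, hik, hil, hjk, hjl, hkl⟩ := mem_distinctQuads.1 hq
  have hπ₁ := forcePair_mem hπ i k
  have hi := forcePair_apply_of_apply_eq hπ₁ hq (forcePair_apply hπ hik)
  rw [stat_conjSwap hsymm (forcePair_mem hπ₁ j l) (by rw [hi]; exact hjk.symm), hi,
    forcePair_apply hπ₁ hjl, contrast]
  ring

theorem integral_stat_sub_le (hsymm : ∀ i j, d i j = d j i) {i j k l : Fin n}
    (hq : (i, j, k, l) ∈ distinctQuads n) {π : Perm (Fin n)} (hπ : π ∈ fpfInvolutions n) :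
    ∫ u in (0 : ℝ)..1, |stat d π - (u * stat d (forcePair j l (forcePair i k π)) +
        (1 - u) * stat d (conjSwap i j (forcePair j l (forcePair i k π))))| ≤
      2 * (editCost d i k π + editCost d j l (forcePair i k π)) +
        (|d i k| + |d j l| + |d i l| + |d j k|) := by
  obtain ⟨hij, hik, hil, hjk, hjl, hkl⟩ := mem_distinctQuads.1 hq
  have hπ₁ := forcePair_mem hπ i k
  have h₁ := stat_forcePair hsymm hπ hik
  have h₂ := stat_forcePair hsymm hπ₁ hjl
  have h₃ := stat_conjSwap_forcePair hsymm hq hπ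
  rw [contrast] at h₃
  generalize forcePair j l (forcePair i k π) = π₂ at *
  generalize forcePair i k π = π₁ at *
  refine (integral_abs_sub_segment_le (α := -2 * (d i k + d j l)) (β := -2 * (d i l + d j k))
    (c := -2 * ((d (π i) (π k) - d (π i) i - d k (π k)) +
      (d (π₁ j) (π₁ l) - d (π₁ j) j - d l (π₁ l)))) fun u => ?_).trans ?_
  · rw [h₃, h₂, h₁, hsymm k i, hsymm l j]; ring
  · have tri : ∀ x y z : ℝ, |x - y - z| ≤ |x| + |y| + |z| := fun x y z => by
      linarith [abs_sub (x - y) z, abs_sub x y]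
    rw [abs_mul, abs_mul, abs_mul, abs_neg, abs_two, editCost, editCost]
    linarith [abs_add_le (d i k) (d j l), abs_add_le (d i l) (d j k),
      abs_add_le (d (π i) (π k) - d (π i) i - d k (π k))
        (d (π₁ j) (π₁ l) - d (π₁ j) j - d l (π₁ l)),
      tri (d (π i) (π k)) (d (π i) i) (d k (π k)),
      tri (d (π₁ j) (π₁ l)) (d (π₁ j) j) (d l (π₁ l))]

theorem sum_integral_stat_sub_le (hsymm : ∀ i j, d i j = d j i) (hn : 5 < n) {i j k l : Fin n}
    (hq : (i, j, k, l) ∈ distinctQuads n) :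
    ∑ π ∈ fpfInvolutions n,
      ∫ u in (0 : ℝ)..1, |stat d π - (u * stat d (forcePair j l (forcePair i k π)) +
        (1 - u) * stat d (conjSwap i j (forcePair j l (forcePair i k π))))| ≤
      (fpfInvolutions n).card * distBound d i j k l := by
  obtain ⟨hij, hik, hil, hjk, hjl, hkl⟩ := mem_distinctQuads.1 hq
  have hn' : (5 : ℝ) < n := by exact_mod_cast hn
  refine (sum_le_sum fun π hπ => integral_stat_sub_le hsymm hq hπ).trans ?_
  rw [sum_add_distrib, ← mul_sum, sum_add_distrib, sum_forcePair hik, sum_const, nsmul_eq_mul]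
  have h1 := sum_editCost_le hsymm relabelInvariant_fpf (notMem_empty i) (notMem_empty k) hik
    (by rw [card_empty, Nat.cast_zero]; linarith)
  have h2 := sum_editCost_le hsymm (relabelInvariant_filter i k) (i := j) (k := l)
    (by simp [hij.symm, hjk]) (by simp [hil.symm, hkl.symm]) hjl
    (by rw [card_pair hik]; push_cast; linarith)
  have h3 := relabelInvariant_fpf.card_eq (notMem_empty i) (notMem_empty k) hik
  rw [card_pair hik] at h2
  simp only [card_empty, Nat.cast_zero, sub_zero, Nat.cast_ofNat] at h1 h2 h3
  rw [show (n : ℝ) - 2 - 1 = n - 3 by ring, show (n : ℝ) - 2 - 3 = n - 5 by ring] at h2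
  have h4 := mul_le_mul_of_nonneg_left h2 (show (0 : ℝ) ≤ n - 1 by linarith)
  rw [← mul_assoc, ← mul_div_assoc, ← h3] at h4
  rw [distBound]
  calc _ ≤ _ := add_le_add_left (mul_le_mul_of_nonneg_left (add_le_add h1 h4) zero_le_two) _
    _ = _ := by ring

end Coupling

section Moments

variable {d : Fin n → Fin n → ℝ}

theorem sum_sq_mul_sum_abs_le {ι : Type*} [Fintype ι] (x : ι → ℝ) :
    (∑ i, x i ^ 2) * ∑ i, |x i| ≤ Fintype.card ι * ∑ i, |x i| ^ 3 := by
  rw [sum_mul_sum]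
  calc ∑ i, ∑ j, x i ^ 2 * |x j| ≤ ∑ i, ∑ j, (2 * |x i| ^ 3 + |x j| ^ 3) / 3 :=
        sum_le_sum fun i _ => sum_le_sum fun j _ => by
          rw [← sq_abs]; exact sq_mul_le (abs_nonneg _) (abs_nonneg _)
    _ = _ := by
        simp only [← sum_div, sum_add_distrib, sum_const, ← mul_sum, card_univ, nsmul_eq_mul]
        ring

theorem sum_contrast_sq_mul_le_of_sum_le (hn : 3 ≤ n) {x : Fin n × Fin n × Fin n × Fin n → ℝ}
    (hx : ∀ q, 0 ≤ x q) (h : ∑ q ∈ distinctQuads n, x q ^ 3 ≤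
      ((n : ℝ) - 2) * ((n : ℝ) - 3) * ∑ i, ∑ j, |d i j| ^ 3) :
    ∑ q ∈ distinctQuads n, contrast d q.1 q.2.1 q.2.2.1 q.2.2.2 ^ 2 * x q ≤
      16 * (((n : ℝ) - 2) * ((n : ℝ) - 3) * ∑ i, ∑ j, |d i j| ^ 3) := by
  linarith [sum_contrast_sq_mul_le (d := d) hn hx]

theorem sum_contrast_sq_mul_absRow_le (hn : 3 ≤ n) {p : Fin n × Fin n × Fin n × Fin n → Fin n}
    (hp : ∀ g : Fin n → ℝ, (∀ i, 0 ≤ g i) → ∑ q ∈ distinctQuads n, g (p q) ≤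
      ((n : ℝ) - 2) * ((n : ℝ) - 3) * (n * ∑ i, g i)) :
    ∑ q ∈ distinctQuads n, contrast d q.1 q.2.1 q.2.2.1 q.2.2.2 ^ 2 * absRow d (p q) ≤
      16 * n * (((n : ℝ) - 2) * ((n : ℝ) - 3) * ∑ i, ∑ j, |d i j| ^ 3) := by
  have hswap : ∑ q ∈ distinctQuads n, contrast d q.1 q.2.1 q.2.2.1 q.2.2.2 ^ 2 *
      absRow d (p q) = ∑ a, ∑ q ∈ distinctQuads n,
        contrast d q.1 q.2.1 q.2.2.1 q.2.2.2 ^ 2 * |d (p q) a| := by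
    simp_rw [absRow, mul_sum]
    rw [sum_comm]
  rw [hswap]
  refine (sum_le_sum fun a _ => sum_contrast_sq_mul_le (d := d) hn
    (x := fun q => |d (p q) a|) fun q => abs_nonneg _).trans ?_
  have h := hp (fun i => ∑ a, |d i a| ^ 3) fun i => sum_nonneg fun a _ => by positivity
  rw [sum_comm] at h
  rw [sum_add_distrib, sum_const, ← mul_sum, card_univ, Fintype.card_fin, nsmul_eq_mul]
  linarith

theorem sum_contrast_sq_mul_distBound_le (hn : 5 < n) :
    ∑ q ∈ distinctQuads n, contrast d q.1 q.2.1 q.2.2.1 q.2.2.2 ^ 2 *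
        distBound d q.1 q.2.1 q.2.2.1 q.2.2.2 ≤
      (2 * ((16 + 32 * n) / ((n : ℝ) - 1) + (16 + 32 * n) / ((n : ℝ) - 3)) + 64) *
        (((n : ℝ) - 2) * ((n : ℝ) - 3) * ∑ i, ∑ j, |d i j| ^ 3) +
      2 * (∑ q ∈ distinctQuads n, contrast d q.1 q.2.1 q.2.2.1 q.2.2.2 ^ 2) *
        (∑ a, absRow d a) *
        (1 / (((n : ℝ) - 3) * ((n : ℝ) - 1)) + 1 / (((n : ℝ) - 5) * ((n : ℝ) - 3))) := by
  have hn3 : 3 ≤ n := by omega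
  have hn' : (5 : ℝ) < n := by exact_mod_cast hn
  have gik : ∀ g : Fin n → Fin n → ℝ, (∀ i k, 0 ≤ g i k) →
      ∑ q ∈ distinctQuads n, g q.1 q.2.2.1 ≤
        ((n : ℝ) - 2) * ((n : ℝ) - 3) * ∑ i, ∑ k, g i k :=
    fun g hg => sum_distinctQuads_fst_le hg hn3
  have gil : ∀ g : Fin n → Fin n → ℝ, (∀ i k, 0 ≤ g i k) →
      ∑ q ∈ distinctQuads n, g q.1 q.2.2.2 ≤
        ((n : ℝ) - 2) * ((n : ℝ) - 3) * ∑ i, ∑ k, g i k := fun g hg =>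
    (sum_distinctQuads_swap_right fun i _ k _ => g i k).trans_le (gik g hg)
  have gjk : ∀ g : Fin n → Fin n → ℝ, (∀ i k, 0 ≤ g i k) →
      ∑ q ∈ distinctQuads n, g q.2.1 q.2.2.1 ≤
        ((n : ℝ) - 2) * ((n : ℝ) - 3) * ∑ i, ∑ k, g i k := fun g hg =>
    (sum_distinctQuads_swap_left fun i _ k _ => g i k).trans_le (gik g hg)
  have gjl : ∀ g : Fin n → Fin n → ℝ, (∀ i k, 0 ≤ g i k) →
      ∑ q ∈ distinctQuads n, g q.2.1 q.2.2.2 ≤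
        ((n : ℝ) - 2) * ((n : ℝ) - 3) * ∑ i, ∑ k, g i k := fun g hg =>
    (sum_distinctQuads_swap_right fun _ j k _ => g j k).trans_le (gjk g hg)
  have hik := sum_contrast_sq_mul_le_of_sum_le (d := d) hn3 (x := fun q => |d q.1 q.2.2.1|)
    (fun _ => abs_nonneg _) (gik (fun i k => |d i k| ^ 3) fun _ _ => by positivity)
  have hil := sum_contrast_sq_mul_le_of_sum_le (d := d) hn3 (x := fun q => |d q.1 q.2.2.2|)
    (fun _ => abs_nonneg _) (gil (fun i k => |d i k| ^ 3) fun _ _ => by positivity)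
  have hjk := sum_contrast_sq_mul_le_of_sum_le (d := d) hn3 (x := fun q => |d q.2.1 q.2.2.1|)
    (fun _ => abs_nonneg _) (gjk (fun i k => |d i k| ^ 3) fun _ _ => by positivity)
  have hjl := sum_contrast_sq_mul_le_of_sum_le (d := d) hn3 (x := fun q => |d q.2.1 q.2.2.2|)
    (fun _ => abs_nonneg _) (gjl (fun i k => |d i k| ^ 3) fun _ _ => by positivity)
  have ri := sum_contrast_sq_mul_absRow_le (d := d) hn3 (p := fun q => q.1) fun g hg => by
    simpa [mul_sum] using gik (fun i _ => g i) fun i _ => hg i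
  have rj := sum_contrast_sq_mul_absRow_le (d := d) hn3 (p := fun q => q.2.1) fun g hg => by
    simpa [mul_sum] using gjk (fun i _ => g i) fun i _ => hg i
  have rk := sum_contrast_sq_mul_absRow_le (d := d) hn3 (p := fun q => q.2.2.1) fun g hg => by
    simpa [mul_sum] using gik (fun _ k => g k) fun _ k => hg k
  have rl := sum_contrast_sq_mul_absRow_le (d := d) hn3 (p := fun q => q.2.2.2) fun g hg => by
    simpa [mul_sum] using gil (fun _ k => g k) fun _ k => hg k
  have hexp : ∑ q ∈ distinctQuads n, contrast d q.1 q.2.1 q.2.2.1 q.2.2.2 ^ 2 *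
        distBound d q.1 q.2.1 q.2.2.1 q.2.2.2 =
      2 / ((n : ℝ) - 1) * (
        ∑ q ∈ distinctQuads n, contrast d q.1 q.2.1 q.2.2.1 q.2.2.2 ^ 2 * |d q.1 q.2.2.1| +
        ∑ q ∈ distinctQuads n, contrast d q.1 q.2.1 q.2.2.1 q.2.2.2 ^ 2 * absRow d q.1 +
        ∑ q ∈ distinctQuads n, contrast d q.1 q.2.1 q.2.2.1 q.2.2.2 ^ 2 * absRow d q.2.2.1) +
      2 / ((n : ℝ) - 3) * (
        ∑ q ∈ distinctQuads n, contrast d q.1 q.2.1 q.2.2.1 q.2.2.2 ^ 2 * |d q.2.1 q.2.2.2| +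
        ∑ q ∈ distinctQuads n, contrast d q.1 q.2.1 q.2.2.1 q.2.2.2 ^ 2 * absRow d q.2.1 +
        ∑ q ∈ distinctQuads n, contrast d q.1 q.2.1 q.2.2.1 q.2.2.2 ^ 2 * absRow d q.2.2.2) +
      (∑ q ∈ distinctQuads n, contrast d q.1 q.2.1 q.2.2.1 q.2.2.2 ^ 2 * |d q.1 q.2.2.1| +
        ∑ q ∈ distinctQuads n, contrast d q.1 q.2.1 q.2.2.1 q.2.2.2 ^ 2 * |d q.2.1 q.2.2.2| +
        ∑ q ∈ distinctQuads n, contrast d q.1 q.2.1 q.2.2.1 q.2.2.2 ^ 2 * |d q.1 q.2.2.2| +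
        ∑ q ∈ distinctQuads n, contrast d q.1 q.2.1 q.2.2.1 q.2.2.2 ^ 2 * |d q.2.1 q.2.2.1|) +
      2 * (∑ q ∈ distinctQuads n, contrast d q.1 q.2.1 q.2.2.1 q.2.2.2 ^ 2) *
        (∑ a, absRow d a) *
        (1 / (((n : ℝ) - 3) * ((n : ℝ) - 1)) + 1 / (((n : ℝ) - 5) * ((n : ℝ) - 3))) := by
    simp only [distBound, one_div, mul_inv]
    generalize ∑ a, absRow d a = M
    simp only [mul_sum, sum_mul, ← sum_add_distrib]
    refine sum_congr rfl fun q _ => ?_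
    ring
  rw [hexp]
  have hA := mul_le_mul_of_nonneg_left (add_le_add (add_le_add hik ri) rk)
    (show (0 : ℝ) ≤ 2 / ((n : ℝ) - 1) from div_nonneg zero_le_two (by linarith))
  have hB := mul_le_mul_of_nonneg_left (add_le_add (add_le_add hjl rj) rl)
    (show (0 : ℝ) ≤ 2 / ((n : ℝ) - 3) from div_nonneg zero_le_two (by linarith))
  refine add_le_add_left ((add_le_add (add_le_add hA hB)
    (add_le_add (add_le_add (add_le_add hik hjl) hil) hjk)).trans (le_of_eq ?_)) _
  ring

theorem const_le {x : ℝ} (hx : 10 ≤ x) :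
    ((2 * ((16 + 32 * x) / (x - 1) + (16 + 32 * x) / (x - 3)) + 64) * ((x - 2) * (x - 3)) +
      2 * (4 * (x - 1) * (x - 2) * x ^ 2) *
        (1 / ((x - 3) * (x - 1)) + 1 / ((x - 5) * (x - 3)))) / (2 * (x - 1) ^ 2 * (x - 3)) ≤
      112 / x + 672 / x ^ 2 + 192 / x ^ 3 := by
  obtain ⟨m, hm, rfl⟩ : ∃ m : ℝ, 0 ≤ m ∧ x = m + 10 := ⟨x - 10, by linarith, by ring⟩
  have h1 : m + 10 - 1 = m + 9 := by ring
  have h2 : m + 10 - 2 = m + 8 := by ring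
  have h3 : m + 10 - 3 = m + 7 := by ring
  have h5 : m + 10 - 5 = m + 5 := by ring
  rw [h1, h2, h3, h5, ← sub_nonneg]
  field_simp
  ring_nf
  positivity

end Moments

section Coupling

variable {d : Fin n → Fin n → ℝ}

/-- The normalizing constant of the square bias law on quadruples. -/
def totalWeight (d : Fin n → Fin n → ℝ) : ℝ :=
  ∑ q ∈ distinctQuads n, contrast d q.1 q.2.1 q.2.2.1 q.2.2.2 ^ 2

/-- The joint law of a uniform fixed-point-free involution and an independent quadruple drawn
with probability proportional to the squared contrast. -/
noncomputable def couplingWeight (d : Fin n → Fin n → ℝ)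
    (a : Perm (Fin n) × Fin n × Fin n × Fin n × Fin n) : ℝ :=
  if a ∈ fpfInvolutions n ×ˢ distinctQuads n then
    contrast d a.2.1 a.2.2.1 a.2.2.2.1 a.2.2.2.2 ^ 2 /
      (totalWeight d * (fpfInvolutions n).card) else 0

theorem totalWeight_nonneg (d : Fin n → Fin n → ℝ) : 0 ≤ totalWeight d :=
  sum_nonneg fun _ _ => sq_nonneg _

theorem couplingWeight_nonneg (d : Fin n → Fin n → ℝ)
    (a : Perm (Fin n) × Fin n × Fin n × Fin n × Fin n) : 0 ≤ couplingWeight d a := by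
  have := totalWeight_nonneg d
  unfold couplingWeight; split_ifs <;> positivity

theorem sum_couplingWeight_mul (F : Perm (Fin n) × Fin n × Fin n × Fin n × Fin n → ℝ) :
    ∑ a, couplingWeight d a * F a =
      (∑ q ∈ distinctQuads n, contrast d q.1 q.2.1 q.2.2.1 q.2.2.2 ^ 2 *
        ∑ π ∈ fpfInvolutions n, F (π, q)) / (totalWeight d * (fpfInvolutions n).card) := by
  simp only [couplingWeight, ite_mul, zero_mul]
  rw [sum_ite_mem, univ_inter, sum_product_right, sum_div]
  refine sum_congr rfl fun q _ => ?_
  rw [mul_sum, sum_div]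
  exact sum_congr rfl fun π _ => by ring

theorem sum_couplingWeight_mul_fst (hZ : totalWeight d ≠ 0) (g : Perm (Fin n) → ℝ) :
    ∑ a, couplingWeight d a * g a.1 =
      (∑ π ∈ fpfInvolutions n, g π) / (fpfInvolutions n).card := by
  rw [sum_couplingWeight_mul fun a => g a.1]
  dsimp only
  rw [← sum_mul, ← totalWeight, mul_div_mul_left _ _ hZ]

theorem sum_couplingWeight_mul_le (hZ : 0 < totalWeight d) (hn : Even n)
    {F : Perm (Fin n) × Fin n × Fin n × Fin n × Fin n → ℝ} {B : Fin n → Fin n → Fin n → Fin n → ℝ}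
    (hF : ∀ i j k l, (i, j, k, l) ∈ distinctQuads n →
      ∑ π ∈ fpfInvolutions n, F (π, i, j, k, l) ≤ (fpfInvolutions n).card * B i j k l) :
    ∑ a, couplingWeight d a * F a ≤
      (∑ q ∈ distinctQuads n, contrast d q.1 q.2.1 q.2.2.1 q.2.2.2 ^ 2 *
        B q.1 q.2.1 q.2.2.1 q.2.2.2) / totalWeight d := by
  have hN : (0 : ℝ) < (fpfInvolutions n).card := by
    exact_mod_cast card_pos.2 (fpfInvolutions_nonempty hn)
  rw [sum_couplingWeight_mul, ← mul_div_mul_right _ (totalWeight d) hN.ne', sum_mul]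
  refine div_le_div_of_nonneg_right (sum_le_sum fun q hq => ?_) (mul_pos hZ hN).le
  rw [mul_assoc, mul_comm (B _ _ _ _)]
  exact mul_le_mul_of_nonneg_left (hF _ _ _ _ hq) (sq_nonneg _)

theorem sum_couplingWeight (hZ : totalWeight d ≠ 0) (hn : Even n) :
    ∑ a, couplingWeight d a = 1 := by
  have h := sum_couplingWeight_mul_fst (d := d) hZ fun _ => 1
  have hN : ((fpfInvolutions n).card : ℝ) ≠ 0 := by
    exact_mod_cast (card_pos.2 (fpfInvolutions_nonempty hn)).ne'
  simpa [hN] using h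

theorem sum_couplingWeight_snd (hZ : totalWeight d ≠ 0) {π : Perm (Fin n)}
    (hπ : π ∈ fpfInvolutions n) :
    ∑ q, couplingWeight d (π, q) = ((fpfInvolutions n).card : ℝ)⁻¹ := by
  simp only [couplingWeight, mem_product, hπ, true_and]
  rw [sum_ite_mem, univ_inter, ← sum_div, ← totalWeight, div_mul_cancel_left₀ hZ]

theorem sum_couplingWeight_smul_dirac (hZ : totalWeight d ≠ 0) :
    ∑ a, ENNReal.ofReal (couplingWeight d a) • Measure.dirac (stat d a.1) =
      ((fpfInvolutions n).card : ℝ≥0∞)⁻¹ •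
        ∑ π ∈ fpfInvolutions n, Measure.dirac (∑ i, d i (π i)) := by
  rw [Fintype.sum_prod_type, smul_sum, ← sum_subset (subset_univ (fpfInvolutions n))]
  · refine sum_congr rfl fun π hπ => ?_
    dsimp only
    rw [← sum_smul, ← ENNReal.ofReal_sum_of_nonneg fun q _ => couplingWeight_nonneg d _,
      sum_couplingWeight_snd hZ hπ, ENNReal.ofReal_inv_of_pos, ENNReal.ofReal_natCast, stat]
    exact_mod_cast card_pos.2 ⟨π, hπ⟩
  · intro π _ hπ
    simp [couplingWeight, hπ]

theorem sum_couplingWeight_zeroBias (hsymm : ∀ i j, d i j = d j i) (hdiag : ∀ i, d i i = 0)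
    (hrow : ∀ i, ∑ j, d i j = 0) (hZ : totalWeight d = 2 * ((n : ℝ) - 1) ^ 2 * ((n : ℝ) - 3))
    (hZ0 : totalWeight d ≠ 0)
    {f : ℝ → ℝ} {I : ℝ → ℝ → ℝ} (hI : ∀ s t, (s - t) * I s t = f s - f t) :
    ∑ a, couplingWeight d a * I
        (stat d (forcePair a.2.2.1 a.2.2.2.2 (forcePair a.2.1 a.2.2.2.1 a.1)))
        (stat d (conjSwap a.2.1 a.2.2.1
          (forcePair a.2.2.1 a.2.2.2.2 (forcePair a.2.1 a.2.2.2.1 a.1)))) =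
      ∑ a, couplingWeight d a * (stat d a.1 * f (stat d a.1)) := by
  rw [sum_couplingWeight_mul_fst hZ0 fun π => stat d π * f (stat d π), sum_couplingWeight_mul]
  have key : ∀ q ∈ distinctQuads n, contrast d q.1 q.2.1 q.2.2.1 q.2.2.2 ^ 2 *
      ∑ π ∈ fpfInvolutions n,
        I (stat d (forcePair q.2.1 q.2.2.2 (forcePair q.1 q.2.2.1 π)))
          (stat d (conjSwap q.1 q.2.1 (forcePair q.2.1 q.2.2.2 (forcePair q.1 q.2.2.1 π)))) =
      ((n : ℝ) - 1) * ((n : ℝ) - 3) / 2 * (contrast d q.1 q.2.1 q.2.2.1 q.2.2.2 *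
        ∑ ρ ∈ pairFiber q.1 q.2.1 q.2.2.1 q.2.2.2,
          (f (stat d ρ) - f (stat d (conjSwap q.1 q.2.1 ρ)))) := by
    rintro ⟨i, j, k, l⟩ hq
    dsimp only
    have h := sum_forcePair_forcePair hq fun ρ =>
      f (stat d ρ) - f (stat d (conjSwap i j ρ))
    have h' : ∑ π ∈ fpfInvolutions n,
        (f (stat d (forcePair j l (forcePair i k π))) -
          f (stat d (conjSwap i j (forcePair j l (forcePair i k π))))) =
        2 * contrast d i j k l * ∑ π ∈ fpfInvolutions n,
          I (stat d (forcePair j l (forcePair i k π)))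
            (stat d (conjSwap i j (forcePair j l (forcePair i k π)))) := by
      rw [mul_sum]
      refine sum_congr rfl fun π hπ => ?_
      rw [← hI, stat_conjSwap_forcePair hsymm hq hπ]
      ring
    rw [h'] at h
    linear_combination contrast d i j k l / 2 * h
  rw [sum_congr rfl key, ← mul_sum, sum_contrast_mul_sum_pairFiber hsymm hdiag hrow]
  rw [← mul_div_mul_left _ ((fpfInvolutions n).card : ℝ) hZ0]
  congr 1
  rw [hZ]
  ring

theorem sum_couplingWeight_dist_le (hsymm : ∀ i j, d i j = d j i) (hdiag : ∀ i, d i i = 0)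
    (hrow : ∀ i, ∑ j, d i j = 0) (hZ : totalWeight d = 2 * ((n : ℝ) - 1) ^ 2 * ((n : ℝ) - 3))
    (hn : Even n) (hn10 : 10 ≤ n) :
    ∑ a, couplingWeight d a * ∫ u in (0 : ℝ)..1, |stat d a.1 -
        (u * stat d (forcePair a.2.2.1 a.2.2.2.2 (forcePair a.2.1 a.2.2.2.1 a.1)) +
          (1 - u) * stat d (conjSwap a.2.1 a.2.2.1
            (forcePair a.2.2.1 a.2.2.2.2 (forcePair a.2.1 a.2.2.2.1 a.1))))| ≤
      (112 / (n : ℝ) + 672 / (n : ℝ) ^ 2 + 192 / (n : ℝ) ^ 3) * ∑ i, ∑ j, |d i j| ^ 3 := by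
  have hn' : (10 : ℝ) ≤ n := by exact_mod_cast hn10
  have hZ0 : 0 < totalWeight d := by
    rw [hZ]; exact mul_pos (mul_pos two_pos (pow_pos (by linarith) 2)) (by linarith)
  have hβ : 0 ≤ ∑ i, ∑ j, |d i j| ^ 3 := by positivity
  have hM : totalWeight d * ∑ a, absRow d a ≤
      4 * ((n : ℝ) - 1) * ((n : ℝ) - 2) * (n : ℝ) ^ 2 * ∑ i, ∑ j, |d i j| ^ 3 := by
    have h := sum_sq_mul_sum_abs_le fun p : Fin n × Fin n => d p.1 p.2
    simp only [Fintype.sum_prod_type, Fintype.card_prod, Fintype.card_fin, Nat.cast_mul] at h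
    have := mul_le_mul_of_nonneg_left h (show 0 ≤ 4 * ((n : ℝ) - 1) * ((n : ℝ) - 2) from
      mul_nonneg (mul_nonneg zero_le_four (by linarith)) (by linarith))
    rw [totalWeight, sum_contrast_sq hsymm hdiag hrow]
    simp only [absRow]
    linarith
  have hbound := sum_contrast_sq_mul_distBound_le (d := d) (n := n) (by omega)
  rw [← totalWeight] at hbound
  have hcoef : 0 ≤ 1 / (((n : ℝ) - 3) * ((n : ℝ) - 1)) + 1 / (((n : ℝ) - 5) * ((n : ℝ) - 3)) :=
    add_nonneg (one_div_nonneg.2 (mul_nonneg (by linarith) (by linarith)))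
      (one_div_nonneg.2 (mul_nonneg (by linarith) (by linarith)))
  have hM' := mul_le_mul_of_nonneg_right (mul_le_mul_of_nonneg_left hM zero_le_two) hcoef
  refine (sum_couplingWeight_mul_le hZ0 hn fun i j k l hq =>
    sum_integral_stat_sub_le hsymm (by omega) hq).trans ?_
  refine le_trans ?_ (mul_le_mul_of_nonneg_right (const_le hn') hβ)
  rw [div_mul_eq_mul_div, ← hZ]
  refine div_le_div_of_nonneg_right ?_ hZ0.le
  linarith

end Coupling

end InvolutionCLT

open InvolutionCLT

/-- Zero-bias coupling for the involution CLT: there is a probability space carrying `W`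
(distributed as `Σ d_{iπ(i)}` for `π` uniform on `Π_n`) and `W*` having the `W`-zero bias
distribution with `E|W − W*| ≤ 112 β_D/n + 672 β_D/n² + 192 β_D/n³`. -/
theorem zero_bias_coupling_involutions (n : ℕ) (hn : Even n) (hn9 : 9 ≤ n)
    (d : Fin n → Fin n → ℝ)
    (hsymm : ∀ i j, d i j = d j i) (hdiag : ∀ i, d i i = 0)
    (hrow : ∀ i, ∑ j, d i j = 0)
    (hvar : 2 * ((n : ℝ) - 2) / (((n : ℝ) - 1) * ((n : ℝ) - 3)) *
      (∑ i, ∑ j, d i j ^ 2) = 1)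
    (βD : ℝ) (hβD : βD = ∑ i, ∑ j, if i ≠ j then |d i j| ^ 3 else 0) :
    ∃ (Ω : Type) (_ : MeasurableSpace Ω) (μ : Measure Ω) (_ : IsProbabilityMeasure μ)
      (W Wstar : Ω → ℝ), Measurable W ∧ Measurable Wstar ∧
      (Measure.map W μ = ((fpfInvolutions n).card : ℝ≥0∞)⁻¹ •
        ∑ π ∈ fpfInvolutions n, Measure.dirac (∑ i, d i (π i))) ∧
      (∀ (f f' : ℝ → ℝ) (K : NNReal), LipschitzWith K f →
        (∀ x, HasDerivAt f (f' x) x) →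
        ∫ ω, W ω * f (W ω) ∂μ = ∫ ω, f' (Wstar ω) ∂μ) ∧
      ∫ ω, |W ω - Wstar ω| ∂μ ≤
        112 * βD / n + 672 * βD / (n : ℝ) ^ 2 + 192 * βD / (n : ℝ) ^ 3 := by
  have hn10 : 10 ≤ n := by
    obtain ⟨m, rfl⟩ := hn
    omega
  have hn' : (10 : ℝ) ≤ n := by exact_mod_cast hn10
  have hZ : totalWeight d = 2 * ((n : ℝ) - 1) ^ 2 * ((n : ℝ) - 3) := by
    have h1 : (n : ℝ) - 1 ≠ 0 := by linarith
    have h3 : (n : ℝ) - 3 ≠ 0 := by linarith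
    rw [totalWeight, sum_contrast_sq hsymm hdiag hrow]
    rw [div_mul_eq_mul_div, div_eq_one_iff_eq (mul_ne_zero h1 h3)] at hvar
    linear_combination 2 * ((n : ℝ) - 1) * hvar
  have hZ0 : totalWeight d ≠ 0 := by
    rw [hZ]
    exact (mul_pos (mul_pos two_pos (pow_pos (by linarith) 2)) (by linarith)).ne'
  have hβ : βD = ∑ i, ∑ j, |d i j| ^ 3 := by
    rw [hβD]
    refine sum_congr rfl fun i _ => sum_congr rfl fun j _ => ?_
    split_ifs with h
    · rfl
    · rw [not_not.1 h, hdiag]; simp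
  let A := Equiv.Perm (Fin n) × Fin n × Fin n × Fin n × Fin n
  let _ : MeasurableSpace A := ⊤
  let y : A → ℝ := fun a => stat d a.1
  let s : A → ℝ := fun a =>
    stat d (forcePair a.2.2.1 a.2.2.2.2 (forcePair a.2.1 a.2.2.2.1 a.1))
  let t : A → ℝ := fun a => stat d (conjSwap a.2.1 a.2.2.1
    (forcePair a.2.2.1 a.2.2.2.2 (forcePair a.2.1 a.2.2.2.1 a.1)))
  have hmeas : ∀ g : A → ℝ, Measurable fun x : A × ℝ => g x.1 := fun g =>
    (measurable_of_finite g).comp measurable_fst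
  have hW : Measurable fun x : A × ℝ => y x.1 := hmeas y
  have hWstar : Measurable fun x : A × ℝ => x.2 * s x.1 + (1 - x.2) * t x.1 :=
    (measurable_snd.mul (hmeas s)).add ((measurable_const.sub measurable_snd).mul (hmeas t))
  have hw : ∀ a : A, 0 ≤ couplingWeight d a := couplingWeight_nonneg d
  refine ⟨A × ℝ, inferInstance, mixture (A := A) (couplingWeight d),
    isProbabilityMeasure_mixture hw (sum_couplingWeight hZ0 hn), fun x => y x.1,
    fun x => x.2 * s x.1 + (1 - x.2) * t x.1, hW, hWstar, ?_, ?_, ?_⟩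
  · rw [map_mixture]
    exact sum_couplingWeight_smul_dirac hZ0
  · intro f f' K hK hf
    have hfm : Measurable f := hK.continuous.measurable
    rw [integral_mixture (F := fun x : A × ℝ => y x.1 * f (y x.1)) hw
        (hW.mul (hfm.comp hW)) fun a =>
          intervalIntegrable_const (c := y a * f (y a)),
      integral_mixture (F := fun x : A × ℝ => f' (x.2 * s x.1 + (1 - x.2) * t x.1)) hw
        ((measurable_of_hasDerivAt hf).comp hWstar)
        fun a => intervalIntegrable_comp_segment hK hf (s a) (t a)]
    simp only [intervalIntegral.integral_const, sub_zero, one_smul]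
    exact (sum_couplingWeight_zeroBias hsymm hdiag hrow hZ hZ0
      (I := fun s t => ∫ u in (0 : ℝ)..1, f' (u * s + (1 - u) * t))
      fun s t => sub_mul_integral_segment hK hf s t).symm
  · have hint : ∀ y s t : ℝ, IntervalIntegrable (fun u => |y - (u * s + (1 - u) * t)|) volume 0 1 :=
      fun y s t => Continuous.intervalIntegrable (by fun_prop) _ _
    rw [integral_mixture (F := fun x : A × ℝ => |y x.1 - (x.2 * s x.1 + (1 - x.2) * t x.1)|) hw
      (hW.sub hWstar).abs fun a => hint (y a) (s a) (t a)]
    refine (sum_couplingWeight_dist_le hsymm hdiag hrow hZ hn hn10).trans (le_of_eq ?_)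
    rw [hβ]; ring
end

section
/- Let n be even, π ∈ Π_n, and let i, j, k, l be four distinct elements of {1,…,n}. Define π† by the following exhaustive and mutually exclusive cases: π† = π α^π_{j,l} if π(i)=k and π(j)≠l; π† = π α^π_{i,k} if π(i)≠k and π(j)=l; π† = π α^π_{j,k} τ_{i,j} τ_{k,l} if π(i)=l and π(j)≠k; π† = π α^π_{i,l} τ_{i,j} τ_{k,l} if π(i)≠l and π(j)=k; π† = π α^π_{k,l} τ_{i,l} τ_{j,k} if π(i)=j and π(k)≠l; π† = π α^π_{i,j} τ_{i,l} τ_{j,k} if π(i)≠j and π(k)=l; π† = π if π(i)=k and π(j)=l; π† = π τ_{i,l} τ_{j,k} if π(i)=j and π(k)=l; π† = π τ_{i,j} τ_{k,l} if π(i)=l and π(j)=k; π† = π α^π_{i,k} α^π_{j,l} if {π(i),π(j)} ∩ {k,l} = ∅ and {π(i),π(k)} ∩ {j,l} = ∅. Then π† ∈ Π_n, π†(i) = k and π†(j) = l. Moreover, setting π‡ = π† α^{π†}_{i,j} and I = {i, j, k, l, π(i), π(j), π(k), π(l)}, the permutations π, π† and π‡ each map I onto itself, are involutions when restricted to I, and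 agree with each other on the complement of I. -/
open Finset

/-- `α^π_{a,b} = τ_{a,π(b)} τ_{b,π(a)}`. -/
def alphaPerm {n : ℕ} (π : Equiv.Perm (Fin n)) (a b : Fin n) : Equiv.Perm (Fin n) :=
  Equiv.swap a (π b) * Equiv.swap b (π a)

/-- The ten-case construction of `π†` from `π ∈ Π_n` and four distinct indices `i,j,k,l`. -/
def piDagger {n : ℕ} (π : Equiv.Perm (Fin n)) (i j k l : Fin n) : Equiv.Perm (Fin n) :=
  if π i = k ∧ π j ≠ l then π * alphaPerm π j l
  else if π i ≠ k ∧ π j = l then π * alphaPerm π i k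
  else if π i = l ∧ π j ≠ k then π * alphaPerm π j k * Equiv.swap i j * Equiv.swap k l
  else if π i ≠ l ∧ π j = k then π * alphaPerm π i l * Equiv.swap i j * Equiv.swap k l
  else if π i = j ∧ π k ≠ l then π * alphaPerm π k l * Equiv.swap i l * Equiv.swap j k
  else if π i ≠ j ∧ π k = l then π * alphaPerm π i j * Equiv.swap i l * Equiv.swap j k
  else if π i = k ∧ π j = l then π
  else if π i = j ∧ π k = l then π * Equiv.swap i l * Equiv.swap j k
  else if π i = l ∧ π j = k then π * Equiv.swap i j * Equiv.swap k l
  else π * alphaPerm π i k * alphaPerm π j l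

/-- `π` is a fixed-point-free involution. -/
def IsMatchingPerm {n : ℕ} (π : Equiv.Perm (Fin n)) : Prop :=
  (∀ x, π (π x) = x) ∧ ∀ x, π x ≠ x

/-- Right multiplication by `α^π_{a,b}` rewires the cycles `(a, π a)`, `(b, π b)` of a
fixed-point-free involution into `(a, b)`, `(π a, π b)`. -/
theorem mul_alphaPerm_apply {n : ℕ} {π : Equiv.Perm (Fin n)} (h : IsMatchingPerm π)
    {a b : Fin n} (hab : a ≠ b) (x : Fin n) :
    (π * alphaPerm π a b) x =
      if x = a then b else if x = b then a else if x = π a then π b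
      else if x = π b then π a else π x := by
  obtain ⟨h1, h2⟩ := h
  simp only [alphaPerm, Equiv.Perm.mul_apply, Equiv.swap_apply_def]
  grind

theorem mul_alphaPerm_apply_left {n : ℕ} {π : Equiv.Perm (Fin n)} (h : IsMatchingPerm π)
    {a b : Fin n} (hab : a ≠ b) : (π * alphaPerm π a b) a = b := by
  rw [mul_alphaPerm_apply h hab, if_pos rfl]

theorem mul_alphaPerm_apply_right {n : ℕ} {π : Equiv.Perm (Fin n)} (h : IsMatchingPerm π)
    {a b : Fin n} (hab : a ≠ b) : (π * alphaPerm π a b) b = a := by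
  rw [mul_alphaPerm_apply h hab, if_neg hab.symm, if_pos rfl]

theorem mul_alphaPerm_apply_of_ne {n : ℕ} {π : Equiv.Perm (Fin n)} (h : IsMatchingPerm π)
    {a b x : Fin n} (hab : a ≠ b) (hxa : x ≠ a) (hxb : x ≠ b) (hπa : π x ≠ a) (hπb : π x ≠ b) :
    (π * alphaPerm π a b) x = π x := by
  have h1 := h.1
  rw [mul_alphaPerm_apply h hab]
  grind

theorem IsMatchingPerm.mul_alphaPerm {n : ℕ} {π : Equiv.Perm (Fin n)} (h : IsMatchingPerm π)
    {a b : Fin n} (hab : a ≠ b) (hπ : π a ≠ b) : IsMatchingPerm (π * alphaPerm π a b) := by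
  have key := mul_alphaPerm_apply h hab
  obtain ⟨h1, h2⟩ := h
  generalize π * alphaPerm π a b = σ at key
  constructor <;> intro x
  · rw [key (σ x), key x]
    grind
  · rw [key x]
    grind

/-- `σ` is a fixed-point-free involution that agrees with `π` outside `S`. -/
def IsRewiring {n : ℕ} (π : Equiv.Perm (Fin n)) (S : Set (Fin n)) (σ : Equiv.Perm (Fin n)) :
    Prop :=
  IsMatchingPerm σ ∧ ∀ x ∉ S, σ x = π x

theorem IsRewiring.mapsTo {n : ℕ} {π σ : Equiv.Perm (Fin n)} {S : Set (Fin n)}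
    (hS : ∀ x ∈ S, π x ∈ S) (hπ : ∀ x, π (π x) = x) (h : IsRewiring π S σ) :
    ∀ x ∈ S, σ x ∈ S := by
  intro x hx
  by_contra hσ
  have h1 := h.2 _ hσ
  rw [h.1.1] at h1
  have h2 := hS x hx
  rw [h1, hπ] at h2
  exact hσ h2

theorem IsRewiring.mul_alphaPerm {n : ℕ} {π σ : Equiv.Perm (Fin n)} {S : Set (Fin n)}
    (hS : ∀ x ∈ S, π x ∈ S) (hπ : ∀ x, π (π x) = x) (h : IsRewiring π S σ)
    {a b : Fin n} (ha : a ∈ S) (hb : b ∈ S) (hab : a ≠ b) (hσ : σ a ≠ b) :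
    IsRewiring π S (σ * alphaPerm σ a b) := by
  refine ⟨h.1.mul_alphaPerm hab hσ, fun x hx => ?_⟩
  have ha' := h.mapsTo hS hπ a ha
  have hb' := h.mapsTo hS hπ b hb
  rw [mul_alphaPerm_apply h.1 hab, ← h.2 x hx]
  grind

/-- If `(i, l)` and `(j, k)` are cycles of `σ`, then `α^σ_{i,k} = τ_{i,j} τ_{k,l}`. -/
theorem alphaPerm_eq_swap_mul_swap {n : ℕ} {σ : Equiv.Perm (Fin n)} {i j k l : Fin n}
    (hi : σ i = l) (hk : σ k = j) :
    alphaPerm σ i k = Equiv.swap i j * Equiv.swap k l := by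
  rw [alphaPerm, hi, hk]

/-- Swapping partners inside `{i, j, k, l}`: if `(i, l)` and `(j, k)` are cycles of `σ`, then
`σ τ_{i,j} τ_{k,l}` has the cycles `(i, k)` and `(j, l)`. -/
theorem IsRewiring.mul_swap_mul_swap {n : ℕ} {π σ : Equiv.Perm (Fin n)} {S : Set (Fin n)}
    (hS : ∀ x ∈ S, π x ∈ S) (hπ : ∀ x, π (π x) = x) (h : IsRewiring π S σ)
    {i j k l : Fin n} (hi : i ∈ S) (hk : k ∈ S) (hik : i ≠ k) (hij : i ≠ j)
    (hjk : j ≠ k) (hjl : j ≠ l) (hkl : k ≠ l)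
    (hσi : σ i = l) (hσk : σ k = j) :
    IsRewiring π S (σ * Equiv.swap i j * Equiv.swap k l) ∧
      (σ * Equiv.swap i j * Equiv.swap k l) i = k ∧
      (σ * Equiv.swap i j * Equiv.swap k l) j = l := by
  have hne : σ i ≠ k := by rw [hσi]; exact hkl.symm
  rw [mul_assoc, ← alphaPerm_eq_swap_mul_swap hσi hσk]
  refine ⟨h.mul_alphaPerm hS hπ hi hk hik hne, ?_, ?_⟩ <;>
  · rw [mul_alphaPerm_apply h.1 hik]
    grind

/-- `π†` has the cycles `(i, k)` and `(j, l)`, and differs from `π` only inside a `π`-stable set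
containing `i, j, k, l`. -/
theorem IsRewiring.piDagger {n : ℕ} {π : Equiv.Perm (Fin n)} {S : Set (Fin n)}
    (hS : ∀ x ∈ S, π x ∈ S) (h : IsMatchingPerm π) {i j k l : Fin n}
    (hi : i ∈ S) (hj : j ∈ S) (hk : k ∈ S) (hl : l ∈ S) (hij : i ≠ j) (hik : i ≠ k) (hil : i ≠ l)
    (hjk : j ≠ k) (hjl : j ≠ l) (hkl : k ≠ l) :
    IsRewiring π S (piDagger π i j k l) ∧
      piDagger π i j k l i = k ∧ piDagger π i j k l j = l := by
  have h0 : IsRewiring π S π := ⟨h, fun _ _ => rfl⟩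
  have hπ := h.1
  have swapped {x y : Fin n} (hxy : π x = y) : π y = x := by rw [← hxy, hπ]
  have keep {a b x y : Fin n} (hab : a ≠ b) (hxa : x ≠ a) (hxb : x ≠ b) (hxy : π x = y)
      (hya : y ≠ a) (hyb : y ≠ b) : (π * alphaPerm π a b) x = y := by
    subst hxy
    exact mul_alphaPerm_apply_of_ne h hab hxa hxb hya hyb
  have parallel {σ : Equiv.Perm (Fin n)} (hσ : IsRewiring π S σ) (h1 : σ i = l) (h2 : σ k = j) :=
    hσ.mul_swap_mul_swap hS hπ hi hk hik hij hjk hjl hkl h1 h2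
  have crossed {σ : Equiv.Perm (Fin n)} (hσ : IsRewiring π S σ) (h1 : σ i = j) (h2 : σ k = l) :
      IsRewiring π S (σ * Equiv.swap i l * Equiv.swap j k) ∧
        (σ * Equiv.swap i l * Equiv.swap j k) i = k ∧
        (σ * Equiv.swap i l * Equiv.swap j k) j = l := by
    rw [Equiv.swap_comm j k]
    obtain ⟨h3, h4, h5⟩ := hσ.mul_swap_mul_swap hS hπ hi hk hik hil hkl.symm hjl.symm hjk.symm h1 h2
    have h6 := h3.1.1 l
    rw [h5] at h6
    exact ⟨h3, h4, h6⟩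
  unfold _root_.piDagger
  split_ifs with c1 c2 c3 c4 c5 c6 c7 c8 c9
  · exact ⟨h0.mul_alphaPerm hS hπ hj hl hjl c1.2,
      keep hjl hij hil c1.1 hjk.symm hkl, mul_alphaPerm_apply_left h hjl⟩
  · exact ⟨h0.mul_alphaPerm hS hπ hi hk hik c2.1,
      mul_alphaPerm_apply_left h hik, keep hik hij.symm hjk c2.2 hil.symm hkl.symm⟩
  · exact parallel (h0.mul_alphaPerm hS hπ hj hk hjk c3.2)
      (keep hjk hij hik c3.1 hjl.symm hkl.symm) (mul_alphaPerm_apply_right h hjk)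
  · exact parallel (h0.mul_alphaPerm hS hπ hi hl hil c4.1)
      (mul_alphaPerm_apply_left h hil) (keep hil hik.symm hkl (swapped c4.2) hij.symm hjl)
  · exact crossed (h0.mul_alphaPerm hS hπ hk hl hkl c5.2)
      (keep hkl hik hil c5.1 hjk hjl) (mul_alphaPerm_apply_left h hkl)
  · exact crossed (h0.mul_alphaPerm hS hπ hi hj hij c6.1)
      (mul_alphaPerm_apply_left h hij) (keep hij hik.symm hjk.symm c6.2 hil.symm hjl.symm)
  · exact ⟨h0, c7⟩
  · exact crossed h0 c8.1 c8.2
  · exact parallel h0 c9.1 (swapped c9.2)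
  · have hπik : π i ≠ k := fun e => c1 ⟨e, fun e' => c7 ⟨e, e'⟩⟩
    have hπil : π i ≠ l := fun e => c3 ⟨e, fun e' => c9 ⟨e, e'⟩⟩
    have hπij : π i ≠ j := fun e => c5 ⟨e, fun e' => c8 ⟨e, e'⟩⟩
    have hπjk : π j ≠ k := fun e => c4 ⟨hπil, e⟩
    have hπjl : π j ≠ l := fun e => c2 ⟨hπik, e⟩
    have hπkl : π k ≠ l := fun e => c6 ⟨hπij, e⟩
    have h1 := h0.mul_alphaPerm hS hπ hi hk hik hπik
    have hj' : (π * alphaPerm π i k) j = π j :=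
      mul_alphaPerm_apply_of_ne h hik hij.symm hjk (fun e => hπij (swapped e)) hπjk
    have hl' : (π * alphaPerm π i k) l = π l :=
      mul_alphaPerm_apply_of_ne h hik hil.symm hkl.symm (fun e => hπil (swapped e))
        (fun e => hπkl (swapped e))
    have hi' : (π * alphaPerm π i k) i = k := mul_alphaPerm_apply_left h hik
    have hα : alphaPerm π j l = alphaPerm (π * alphaPerm π i k) j l := by
      rw [alphaPerm, alphaPerm, hj', hl']
    rw [hα]
    exact ⟨h1.mul_alphaPerm hS hπ hj hl hjl (hj'.trans_ne hπjl),
      (mul_alphaPerm_apply_of_ne h1.1 hjl hij hil (hi'.trans_ne hjk.symm)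
        (hi'.trans_ne hkl)).trans hi',
      mul_alphaPerm_apply_left h1.1 hjl⟩

/-- Properties of the construction `π†`: it is a fixed-point-free involution with cycles
`(i,k)` and `(j,l)`, and `π`, `π†`, `π‡ = π† α^{π†}_{i,j}` map
`I = {i,j,k,l,π(i),π(j),π(k),π(l)}` onto itself, are involutions when restricted to `I`,
and agree with each other on the complement of `I`. -/
theorem piDagger_properties {n : ℕ} (hn : Even n) (π : Equiv.Perm (Fin n))
    (hinv : π * π = 1) (hfpf : ∀ x, π x ≠ x)
    (i j k l : Fin n) (hij : i ≠ j) (hik : i ≠ k) (hil : i ≠ l)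
    (hjk : j ≠ k) (hjl : j ≠ l) (hkl : k ≠ l) :
    let πd := piDagger π i j k l
    let πdd := πd * alphaPerm πd i j
    let I : Set (Fin n) := {i, j, k, l, π i, π j, π k, π l}
    (πd * πd = 1 ∧ ∀ x, πd x ≠ x) ∧ πd i = k ∧ πd j = l ∧
      (∀ x ∈ I, π x ∈ I) ∧ (∀ x ∈ I, πd x ∈ I) ∧ (∀ x ∈ I, πdd x ∈ I) ∧
      (∀ x ∈ I, π (π x) = x) ∧ (∀ x ∈ I, πd (πd x) = x) ∧ (∀ x ∈ I, πdd (πdd x) = x) ∧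
      (∀ x ∉ I, π x = πd x ∧ πd x = πdd x) := by
  intro πd πdd I
  have h : IsMatchingPerm π := ⟨fun x => by simpa using congrArg (fun σ => σ x) hinv, hfpf⟩
  have hS : ∀ x ∈ I, π x ∈ I := by
    rintro x (rfl | rfl | rfl | rfl | rfl | rfl | rfl | rfl) <;> simp [I, h.1]
  have hi : i ∈ I := by simp [I]
  have hj : j ∈ I := by simp [I]
  obtain ⟨hd, hdi, hdj⟩ : IsRewiring π I πd ∧ πd i = k ∧ πd j = l :=
    IsRewiring.piDagger hS h hi hj (by simp [I]) (by simp [I]) hij hik hil hjk hjl hkl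
  have hdd : IsRewiring π I πdd :=
    hd.mul_alphaPerm hS h.1 hi hj hij (by rw [hdi]; exact hjk.symm)
  exact ⟨⟨Equiv.ext hd.1.1, hd.1.2⟩, hdi, hdj, hS, hd.mapsTo hS h.1, hdd.mapsTo hS h.1,
    fun x _ => h.1 x, fun x _ => hd.1.1 x, fun x _ => hdd.1.1 x,
    fun x hx => ⟨(hd.2 x hx).symm, (hd.2 x hx).trans (hdd.2 x hx).symm⟩⟩
end

section
/- Let n ≥ 4 be even and D = (d_{ij}) a standardized n×n array. Then Σ_{(i,j,k,l): i,j,k,l distinct} [d_{ik} + d_{jl} − (d_{ij} + d_{kl})]² = 2(n−1)²(n−3), i.e. c_n Σ_{|{i,j,k,l}|=4} [d_{ik} + d_{jl} − (d_{ij} + d_{kl})]² = 1 with c_n = 1/(2(n−1)²(n−3)). Moreover c_n ≤ 1/n³ when n ≥ 9. -/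
open Finset

section DistinctSums

variable {ι : Type*} [Fintype ι]

/-- For an array with zero row sums, all cross terms of the four-index sum vanish. -/
lemma sum_four_sq_of_row_sum_zero (d : ι → ι → ℝ) (hsymm : ∀ i j, d i j = d j i)
    (hrow : ∀ i, ∑ j, d i j = 0) :
    (∑ i, ∑ j, ∑ k, ∑ l, (d i k + d j l - (d i j + d k l)) ^ 2) =
      4 * (Fintype.card ι : ℝ) ^ 2 * ∑ i, ∑ j, d i j ^ 2 := by
  have hcol : ∀ j, ∑ i, d i j = 0 := fun j => by simpa only [hsymm _ j] using hrow j
  have inner_l : ∀ i j k, ∑ l, (d i k + d j l - (d i j + d k l)) ^ 2 =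
      Fintype.card ι * (d i k ^ 2 + d i j ^ 2 - 2 * (d i k * d i j)) +
        ∑ l, d j l ^ 2 + ∑ l, d k l ^ 2 - 2 * ∑ l, d j l * d k l := by
    intro i j k
    have h : ∀ l, (d i k + d j l - (d i j + d k l)) ^ 2 =
        (d i k ^ 2 + d i j ^ 2 - 2 * (d i k * d i j)) + d j l ^ 2 + d k l ^ 2 -
          2 * (d j l * d k l) + 2 * (d i k - d i j) * d j l -
          2 * (d i k - d i j) * d k l := fun l => by ring
    simp only [h, sum_add_distrib, sum_sub_distrib, ← mul_sum, hrow, sum_const, card_univ,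
      nsmul_eq_mul]
    ring
  have cross : ∀ j, ∑ k, ∑ l, d j l * d k l = 0 := by
    intro j
    rw [sum_comm]
    simp [← mul_sum, hcol]
  have inner_k : ∀ i j, ∑ k, ∑ l, (d i k + d j l - (d i j + d k l)) ^ 2 =
      Fintype.card ι * (∑ k, d i k ^ 2) + (Fintype.card ι : ℝ) ^ 2 * d i j ^ 2 +
        Fintype.card ι * (∑ l, d j l ^ 2) + ∑ k, ∑ l, d k l ^ 2 := by
    intro i j
    simp only [inner_l, sum_add_distrib, sum_sub_distrib, ← mul_sum, ← sum_mul, hrow, cross,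
      sum_const, card_univ, nsmul_eq_mul]
    ring
  simp only [inner_k, sum_add_distrib, ← mul_sum, sum_const, card_univ, nsmul_eq_mul]
  ring

/-- For an array with zero row sums, all cross terms of the three-index sum vanish. -/
lemma sum_three_sq_of_row_sum_zero (d : ι → ι → ℝ) (hsymm : ∀ i j, d i j = d j i)
    (hrow : ∀ i, ∑ j, d i j = 0) :
    (∑ i, ∑ j, ∑ k, (d i j + d i k - d j k) ^ 2) =
      3 * (Fintype.card ι : ℝ) * ∑ i, ∑ j, d i j ^ 2 := by
  have hcol : ∀ j, ∑ i, d i j = 0 := fun j => by simpa only [hsymm _ j] using hrow j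
  have inner : ∀ i j, ∑ k, (d i j + d i k - d j k) ^ 2 =
      Fintype.card ι * d i j ^ 2 + ∑ k, d i k ^ 2 + ∑ k, d j k ^ 2 -
        2 * ∑ k, d i k * d j k := by
    intro i j
    have h : ∀ k, (d i j + d i k - d j k) ^ 2 =
        d i j ^ 2 + d i k ^ 2 + d j k ^ 2 - 2 * (d i k * d j k) +
          2 * d i j * d i k - 2 * d i j * d j k := fun k => by ring
    simp only [h, sum_add_distrib, sum_sub_distrib, ← mul_sum, hrow, sum_const, card_univ,
      nsmul_eq_mul]
    ring
  have cross : ∀ i, ∑ j, ∑ k, d i k * d j k = 0 := by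
    intro i
    rw [sum_comm]
    simp [← mul_sum, hcol]
  simp only [inner, sum_add_distrib, sum_sub_distrib, ← mul_sum, cross, sum_const, card_univ,
    nsmul_eq_mul]
  ring

/-- The sum over distinct quadruples, for a symmetric array with zero diagonal and row sums. -/
lemma sum_distinct_four_sq [DecidableEq ι] (d : ι → ι → ℝ) (hsymm : ∀ i j, d i j = d j i)
    (hdiag : ∀ i, d i i = 0) (hrow : ∀ i, ∑ j, d i j = 0) :
    (∑ i, ∑ j, ∑ k, ∑ l, if [i, j, k, l].Nodup then
        (d i k + d j l - (d i j + d k l)) ^ 2 else 0) =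
      4 * ((Fintype.card ι : ℝ) - 1) * ((Fintype.card ι : ℝ) - 2) *
        ∑ i, ∑ j, d i j ^ 2 := by
  -- The summand vanishes if `i = l` or `j = k`, which truncates inclusion-exclusion.
  have split : ∀ i j k l, (if [i, j, k, l].Nodup then
        (d i k + d j l - (d i j + d k l)) ^ 2 else 0) =
      (d i k + d j l - (d i j + d k l)) ^ 2
        - (if i = j then (d i k + d i l - d k l) ^ 2 else 0)
        - (if i = k then (d i j + d i l - d j l) ^ 2 else 0)
        - (if j = l then (d j i + d j k - d i k) ^ 2 else 0)
        - (if k = l then (d k i + d k j - d i j) ^ 2 else 0)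
        + (if i = j then if k = l then 4 * d i k ^ 2 else 0 else 0)
        + (if i = k then if j = l then 4 * d i j ^ 2 else 0 else 0) := by
    intro i j k l
    by_cases hil : i = l
    · subst hil
      by_cases hij : i = j <;> by_cases hik : i = k <;>
        simp_all [eq_comm]; ring
    by_cases hjk : j = k
    · subst hjk
      by_cases hij : i = j <;> by_cases hjl : j = l <;>
        simp_all [eq_comm]
    by_cases hij : i = j <;> by_cases hik : i = k <;> by_cases hjl : j = l <;>
      by_cases hkl : k = l <;> simp_all [eq_comm] <;> grind
  have three := sum_three_sq_of_row_sum_zero d hsymm hrow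
  have sum_ij : (∑ i, ∑ j, ∑ k, ∑ l,
      if i = j then (d i k + d i l - d k l) ^ 2 else 0) =
      3 * (Fintype.card ι : ℝ) * ∑ i, ∑ j, d i j ^ 2 := by
    rw [← three]
    refine sum_congr rfl fun i _ => ?_
    rw [sum_eq_single i] <;> simp +contextual [eq_comm]
  have sum_ik : (∑ i, ∑ j, ∑ k, ∑ l,
      if i = k then (d i j + d i l - d j l) ^ 2 else 0) =
      3 * (Fintype.card ι : ℝ) * ∑ i, ∑ j, d i j ^ 2 := by
    rw [← three]
    refine sum_congr rfl fun i _ => sum_congr rfl fun j _ => ?_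
    rw [sum_eq_single i] <;> simp +contextual [eq_comm]
  have sum_jl : (∑ i, ∑ j, ∑ k, ∑ l,
      if j = l then (d j i + d j k - d i k) ^ 2 else 0) =
      3 * (Fintype.card ι : ℝ) * ∑ i, ∑ j, d i j ^ 2 := by
    rw [← three, sum_comm]
    simp
  have sum_kl : (∑ i, ∑ j, ∑ k, ∑ l,
      if k = l then (d k i + d k j - d i j) ^ 2 else 0) =
      3 * (Fintype.card ι : ℝ) * ∑ i, ∑ j, d i j ^ 2 := by
    rw [← three]
    simp only [sum_ite_eq, mem_univ, if_true]
    calc _ = ∑ i, ∑ k, ∑ j, (d k i + d k j - d i j) ^ 2 :=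
          sum_congr rfl fun i _ => sum_comm
      _ = _ := sum_comm
  have sum_ij_kl : (∑ i, ∑ j, ∑ k, ∑ l,
      if i = j then if k = l then 4 * d i k ^ 2 else 0 else 0) =
      4 * ∑ i, ∑ j, d i j ^ 2 := by
    simp only [mul_sum]
    refine sum_congr rfl fun i _ => ?_
    rw [sum_eq_single i] <;> simp +contextual [eq_comm]
  have sum_ik_jl : (∑ i, ∑ j, ∑ k, ∑ l,
      if i = k then if j = l then 4 * d i j ^ 2 else 0 else 0) =
      4 * ∑ i, ∑ j, d i j ^ 2 := by
    simp only [mul_sum]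
    refine sum_congr rfl fun i _ => sum_congr rfl fun j _ => ?_
    rw [sum_eq_single i] <;> simp +contextual [eq_comm]
  simp only [split, sum_add_distrib, sum_sub_distrib]
  rw [sum_four_sq_of_row_sum_zero d hsymm hrow, sum_ij, sum_ik, sum_jl, sum_kl, sum_ij_kl,
    sum_ik_jl]
  ring

end DistinctSums

/-- Normalization of the square-bias index distribution: for a standardized array,
`Σ_{|{i,j,k,l}|=4} [d_{ik} + d_{jl} − (d_{ij} + d_{kl})]² = 2(n−1)²(n−3)`, and
`c_n = 1/(2(n−1)²(n−3)) ≤ 1/n³` when `n ≥ 9`. -/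
theorem square_bias_normalization (n : ℕ) (hn : Even n) (hn4 : 4 ≤ n)
    (d : Fin n → Fin n → ℝ)
    (hsymm : ∀ i j, d i j = d j i) (hdiag : ∀ i, d i i = 0)
    (hrow : ∀ i, ∑ j, d i j = 0)
    (hvar : 2 * ((n : ℝ) - 2) / (((n : ℝ) - 1) * ((n : ℝ) - 3)) *
      (∑ i, ∑ j, d i j ^ 2) = 1) :
    (∑ i, ∑ j, ∑ k, ∑ l, if [i, j, k, l].Nodup then
        (d i k + d j l - (d i j + d k l)) ^ 2 else 0) =
      2 * ((n : ℝ) - 1) ^ 2 * ((n : ℝ) - 3) ∧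
    (9 ≤ n → 1 / (2 * ((n : ℝ) - 1) ^ 2 * ((n : ℝ) - 3)) ≤ 1 / (n : ℝ) ^ 3) := by
  have hn' : (4 : ℝ) ≤ n := by exact_mod_cast hn4
  have h1 : (n : ℝ) - 1 ≠ 0 := by linarith
  have h3 : (n : ℝ) - 3 ≠ 0 := by linarith
  constructor
  · rw [sum_distinct_four_sq d hsymm hdiag hrow, Fintype.card_fin]
    field_simp at hvar
    linear_combination 2 * ((n : ℝ) - 1) * hvar
  · intro hn9
    have hn9' : (9 : ℝ) ≤ n := by exact_mod_cast hn9
    apply one_div_le_one_div_of_le (by positivity)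
    nlinarith [mul_nonneg (sub_nonneg.2 hn9') (sub_nonneg.2 hn9'),
      mul_nonneg (mul_nonneg (sub_nonneg.2 hn9') (sub_nonneg.2 hn9')) (sub_nonneg.2 hn9')]
end

section
/- Let n ≥ 4 be even and D = (d_{ij}) an n×n real array with d_{ij} = d_{ji} and d_{ii} = 0 for all i, j. Let π be uniform on Π_n, let (I, J) be an ordered pair of distinct indices chosen uniformly from {1,…,n} and independent of π, and set W = Σ_i d_{iπ(i)}, π′ = π α^π_{I,J}, and W′ = Σ_i d_{iπ′(i)}, so that W − W′ = 2(d_{Iπ(I)} + d_{Jπ(J)} − (d_{IJ} + d_{π(I)π(J)})). Then E(W − W′)² = (4/(n(n−1)²(n−3))) · Σ_{(i,j,k,l): i,j,k,l distinct} (d_{ik} + d_{jl} − (d_{ij} + d_{kl}))². -/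
open Finset

lemma mem_fpfInvolutions {n : ℕ} {π : Equiv.Perm (Fin n)} :
    π ∈ fpfInvolutions n ↔ (∀ i, π (π i) = i) ∧ ∀ i, π i ≠ i := by
  simp [fpfInvolutions, Equiv.ext_iff]

lemma fpfInvolutions_nonempty {n : ℕ} (hn : Even n) : (fpfInvolutions n).Nonempty := by
  refine ⟨Fin.revPerm, mem_fpfInvolutions.2 ⟨fun i => by simp, fun i h => ?_⟩⟩
  obtain ⟨m, rfl⟩ := hn
  have := congrArg Fin.val h
  simp only [Fin.revPerm_apply, Fin.val_rev] at this
  lia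

lemma nodup_image_iff {n : ℕ} {π : Equiv.Perm (Fin n)} (hπ : π ∈ fpfInvolutions n) (i j : Fin n) :
    [i, j, π i, π j].Nodup ↔ i ≠ j ∧ j ≠ π i := by
  obtain ⟨hinv, hfix⟩ := mem_fpfInvolutions.1 hπ
  have := hinv i
  have := hinv j
  have := hfix i
  have := hfix j
  simp only [List.nodup_cons, List.mem_cons, List.not_mem_nil]
  grind

lemma sum_sub_sum_mul_alphaPerm {n : ℕ} {d : Fin n → Fin n → ℝ} (hsymm : ∀ i j, d i j = d j i)
    {π : Equiv.Perm (Fin n)} (hπ : π ∈ fpfInvolutions n) {i j : Fin n} (hij : i ≠ j) :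
    (∑ a, d a (π a)) - (∑ a, d a ((π * alphaPerm π i j) a)) =
      2 * (d i (π i) + d j (π j) - (d i j + d (π i) (π j))) := by
  obtain ⟨hinv, hfix⟩ := mem_fpfInvolutions.1 hπ
  by_cases hj : j = π i
  · subst hj
    simp [alphaPerm, hinv, hsymm (π i) i]
  have hnd := (nodup_image_iff hπ i j).2 ⟨hij, hj⟩
  simp only [List.nodup_cons, List.mem_cons, List.not_mem_nil, not_or, or_false,
    List.nodup_nil, and_true, not_false_eq_true] at hnd
  obtain ⟨⟨-, h1, h2⟩, ⟨h3, h4⟩, h5⟩ := hnd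
  rw [← sum_sub_distrib, ← sum_subset (subset_univ {i, j, π i, π j})]
  · rw [sum_insert (by simp [hij, h1, h2]), sum_insert (by simp [h3, h4]),
      sum_insert (by simp [hij]), sum_singleton]
    have e1 : (π * alphaPerm π i j) i = j := by
      simp [alphaPerm, Equiv.swap_apply_of_ne_of_ne hij h1, hinv]
    have e2 : (π * alphaPerm π i j) j = i := by
      simp [alphaPerm, Equiv.swap_apply_of_ne_of_ne (hfix i) h5, hinv]
    have e3 : (π * alphaPerm π i j) (π i) = π j := by
      simp [alphaPerm, Equiv.swap_apply_of_ne_of_ne hij.symm h4]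
    have e4 : (π * alphaPerm π i j) (π j) = π i := by
      simp [alphaPerm, Equiv.swap_apply_of_ne_of_ne (hfix j) (Ne.symm h5)]
    rw [e1, e2, e3, e4, hinv, hinv, hsymm (π i) i, hsymm (π j) j, hsymm j i, hsymm (π j) (π i)]
    ring
  · intro a _ ha
    simp only [mem_insert, mem_singleton, not_or] at ha
    obtain ⟨a1, a2, a3, a4⟩ := ha
    simp [alphaPerm, Equiv.swap_apply_of_ne_of_ne a2 a3, Equiv.swap_apply_of_ne_of_ne a1 a4]

lemma sum_ite_nodup_append_singleton {n : ℕ} (L : List (Fin n)) (c : ℝ) :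
    (∑ x, if (L ++ [x]).Nodup then c else 0) = if L.Nodup then ((n : ℝ) - L.length) * c else 0 := by
  by_cases hL : L.Nodup
  · have h : ∀ x : Fin n, (L ++ [x]).Nodup ↔ x ∉ L.toFinset := fun x => by
      rw [← List.concat_eq_append, List.nodup_concat]
      simp [hL]
    have hle : L.length ≤ n := by simpa using hL.length_le_card
    simp only [h, if_pos hL, ← sum_filter, sum_const, nsmul_eq_mul]
    rw [filter_not, filter_mem_eq_inter, univ_inter, card_sdiff_of_subset (subset_univ _),
      List.toFinset_card_of_nodup hL, card_univ, Fintype.card_fin, Nat.cast_sub hle]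
  · rw [if_neg hL]
    exact sum_eq_zero fun x _ => if_neg fun h => hL h.of_append_left

lemma sum_ite_nodup_four (n : ℕ) (c : ℝ) :
    (∑ i : Fin n, ∑ j, ∑ k, ∑ l, if [i, j, k, l].Nodup then c else 0) =
      n * (n - 1) * (n - 2) * (n - 3) * c := by
  have h4 (i j k : Fin n) := sum_ite_nodup_append_singleton [i, j, k] c
  have h3 (i j : Fin n) := sum_ite_nodup_append_singleton [i, j] (((n : ℝ) - 3) * c)
  have h2 (i : Fin n) := sum_ite_nodup_append_singleton [i] (((n : ℝ) - 2) * (((n : ℝ) - 3) * c))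
  simp only [List.cons_append, List.nil_append, List.length_cons, List.length_nil] at h4 h3 h2
  norm_num only at h4 h3 h2
  simp only [h4, h3, h2, List.nodup_singleton, if_true, sum_const, card_univ, Fintype.card_fin,
    nsmul_eq_mul]
  ring

/-- The number of `π ∈ Π_n` with `π i = k` and `π j = l`. -/
def fpfCount {n : ℕ} (i j k l : Fin n) : ℕ :=
  #{π ∈ fpfInvolutions n | π i = k ∧ π j = l}

lemma fpfCount_perm {n : ℕ} (σ : Equiv.Perm (Fin n)) (i j k l : Fin n) :
    fpfCount (σ i) (σ j) (σ k) (σ l) = fpfCount i j k l := by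
  symm
  refine card_equiv (MulAut.conj σ).toEquiv fun π => ?_
  have h (f : Fin n → Prop) : (∀ i, f i) ↔ ∀ i, f (σ i) := σ.surjective.forall
  simp only [mem_filter, mem_fpfInvolutions]
  rw [h fun i => (MulAut.conj σ).toEquiv π _ = i, h fun i => (MulAut.conj σ).toEquiv π i ≠ i]
  simp

lemma fpfCount_eq_of_nodup {n : ℕ} {i j k l i' j' k' l' : Fin n} (h : [i, j, k, l].Nodup)
    (h' : [i', j', k', l'].Nodup) : fpfCount i j k l = fpfCount i' j' k' l' := by
  have hx : Function.Injective ![i, j, k, l] := List.nodup_ofFn.1 (by simpa using h)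
  have hy : Function.Injective ![i', j', k', l'] := List.nodup_ofFn.1 (by simpa using h')
  obtain ⟨σ, hσ⟩ := (Equiv.Perm.isMultiplyPretransitive (Fin n) 4).exists_smul_eq
    ⟨_, hx⟩ ⟨_, hy⟩
  have hσ' (t : Fin 4) : σ (![i, j, k, l] t) = ![i', j', k', l'] t := DFunLike.congr_fun hσ t
  rw [← fpfCount_perm σ, show σ i = i' from hσ' 0, show σ j = j' from hσ' 1,
    show σ k = k' from hσ' 2, show σ l = l' from hσ' 3]

lemma sum_fpfInvolutions_eq {n : ℕ} (f : Fin n → Fin n → Fin n → Fin n → ℝ) :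
    (∑ π ∈ fpfInvolutions n, ∑ i, ∑ j, f i j (π i) (π j)) =
      ∑ i, ∑ j, ∑ k, ∑ l, (fpfCount i j k l : ℝ) * f i j k l := by
  rw [sum_comm]
  refine sum_congr rfl fun i _ => ?_
  rw [sum_comm]
  refine sum_congr rfl fun j _ => ?_
  have h (k l : Fin n) : (fpfCount i j k l : ℝ) * f i j k l =
      ∑ π ∈ fpfInvolutions n, if π i = k ∧ π j = l then f i j k l else 0 := by
    rw [← sum_filter, sum_const, nsmul_eq_mul, fpfCount]
  simp_rw [h]
  rw [sum_congr rfl fun k _ => sum_comm, sum_comm]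
  refine sum_congr rfl fun π _ => ?_
  simp [ite_and]

lemma card_fpfInvolutions_eq {n : ℕ} (hn4 : 4 ≤ n) {i j k l : Fin n} (h : [i, j, k, l].Nodup) :
    ((fpfInvolutions n).card : ℝ) = (n - 1) * (n - 3) * fpfCount i j k l := by
  have hn : (4 : ℝ) ≤ n := by exact_mod_cast hn4
  have hsum := sum_fpfInvolutions_eq (n := n)
    fun i j k l => if [i, j, k, l].Nodup then (1 : ℝ) else 0
  have hright : ∀ a b c e : Fin n,
      (fpfCount a b c e : ℝ) * (if [a, b, c, e].Nodup then (1 : ℝ) else 0) =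
        if [a, b, c, e].Nodup then (fpfCount i j k l : ℝ) else 0 := fun a b c e => by
    split_ifs with h'
    · rw [mul_one, fpfCount_eq_of_nodup h' h]
    · rw [mul_zero]
  simp_rw [hright] at hsum
  rw [sum_ite_nodup_four] at hsum
  have hleft : ∀ π ∈ fpfInvolutions n,
      (∑ a, ∑ b, if [a, b, π a, π b].Nodup then (1 : ℝ) else 0) = n * (n - 2) := fun π hπ => by
    have hpair (a : Fin n) : [a, π a].Nodup := by
      simpa using ((mem_fpfInvolutions.1 hπ).2 a).symm
    have hiff (a b : Fin n) : [a, b, π a, π b].Nodup ↔ ([a, π a] ++ [b]).Nodup := by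
      have := (mem_fpfInvolutions.1 hπ).2 a
      rw [nodup_image_iff hπ]
      simp only [List.cons_append, List.nil_append, List.nodup_cons, List.mem_cons,
        List.not_mem_nil]
      grind
    simp_rw [hiff, sum_ite_nodup_append_singleton, if_pos (hpair _)]
    simp [mul_sub]
  rw [sum_congr rfl hleft, sum_const, nsmul_eq_mul] at hsum
  have hne : (n : ℝ) * (n - 2) ≠ 0 := mul_ne_zero (by linarith) (by linarith)
  apply mul_right_cancel₀ hne
  rw [hsum]
  ring

/-- For `π` uniform on `Π_n`, `(I,J)` a uniform ordered pair of distinct indices independent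
of `π`, `W = Σ d_{iπ(i)}` and `W′ = Σ d_{iπ′(i)}` with `π′ = π α^π_{I,J}`, one has
`W − W′ = 2(d_{Iπ(I)} + d_{Jπ(J)} − (d_{IJ} + d_{π(I)π(J)}))` and
`E(W − W′)² = (4/(n(n−1)²(n−3))) Σ_{|{i,j,k,l}|=4} (d_{ik} + d_{jl} − (d_{ij} + d_{kl}))²`. -/
theorem expected_square_difference (n : ℕ) (hn : Even n) (hn4 : 4 ≤ n)
    (d : Fin n → Fin n → ℝ)
    (hsymm : ∀ i j, d i j = d j i) (hdiag : ∀ i, d i i = 0) :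
    (∀ π ∈ fpfInvolutions n, ∀ i j : Fin n, i ≠ j →
      (∑ a, d a (π a)) - (∑ a, d a ((π * alphaPerm π i j) a)) =
        2 * (d i (π i) + d j (π j) - (d i j + d (π i) (π j)))) ∧
    (∑ π ∈ fpfInvolutions n, ∑ i, ∑ j, if i ≠ j then
        ((∑ a, d a (π a)) - (∑ a, d a ((π * alphaPerm π i j) a))) ^ 2 else 0) /
        (((fpfInvolutions n).card : ℝ) * ((n : ℝ) * ((n : ℝ) - 1))) =
      4 / ((n : ℝ) * ((n : ℝ) - 1) ^ 2 * ((n : ℝ) - 3)) *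
        ∑ i, ∑ j, ∑ k, ∑ l, if [i, j, k, l].Nodup then
          (d i k + d j l - (d i j + d k l)) ^ 2 else 0 := by
  refine ⟨fun π hπ i j hij => sum_sub_sum_mul_alphaPerm hsymm hπ hij, ?_⟩
  have hn4' : (4 : ℝ) ≤ n := by exact_mod_cast hn4
  have hcard : ((fpfInvolutions n).card : ℝ) ≠ 0 := by
    exact_mod_cast (fpfInvolutions_nonempty hn).card_ne_zero
  have hterm : ∀ π ∈ fpfInvolutions n, ∀ i j : Fin n,
      (if i ≠ j then
        ((∑ a, d a (π a)) - (∑ a, d a ((π * alphaPerm π i j) a))) ^ 2 else 0) =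
      if [i, j, π i, π j].Nodup then
        4 * (d i (π i) + d j (π j) - (d i j + d (π i) (π j))) ^ 2 else 0 := by
    intro π hπ i j
    by_cases hij : i = j
    · simp [hij]
    rw [if_pos hij, sum_sub_sum_mul_alphaPerm hsymm hπ hij]
    simp only [nodup_image_iff hπ]
    by_cases hj : j = π i
    · simp [hj, (mem_fpfInvolutions.1 hπ).1, hsymm (π i) i]
    · rw [if_pos ⟨hij, hj⟩]
      ring
  rw [sum_congr rfl fun π hπ => sum_congr rfl fun i _ => sum_congr rfl fun j _ => hterm π hπ i j,
    sum_fpfInvolutions_eq fun i j k l => if [i, j, k, l].Nodup then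
      4 * (d i k + d j l - (d i j + d k l)) ^ 2 else 0]
  simp_rw [sum_div, mul_sum]
  refine sum_congr rfl fun i _ => sum_congr rfl fun j _ => sum_congr rfl fun k _ =>
    sum_congr rfl fun l _ => ?_
  split_ifs with h
  · rw [card_fpfInvolutions_eq hn4 h] at hcard ⊢
    have h0 : (n : ℝ) ≠ 0 := by linarith
    have h1 : (n : ℝ) - 1 ≠ 0 := by linarith
    have h3 : (n : ℝ) - 3 ≠ 0 := by linarith
    have hc : (fpfCount i j k l : ℝ) ≠ 0 := right_ne_zero_of_mul hcard
    field_simp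
  · simp
end

section
/- Let n ≥ 9 be even and D = (d_{ij}) a standardized n×n array, and let c_n = 1/(2(n−1)²(n−3)). Then c_n · Σ_{(i,j,k,l): i,j,k,l distinct} |d_{ik}| · [d_{ik} + d_{jl} − (d_{ij} + d_{kl})]² ≤ 4 β_D / n. -/
open Finset

/-- A weighted form of Young's inequality. -/
lemma abs_mul_sq_le_cubes (x y : ℝ) : |x| * y ^ 2 ≤ (|x| ^ 3 + 2 * |y| ^ 3) / 3 := by
  rw [← sq_abs y]
  nlinarith [abs_nonneg x, abs_nonneg y,
    mul_nonneg (add_nonneg (abs_nonneg x) (mul_nonneg zero_le_two (abs_nonneg y)))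
      (sq_nonneg (|x| - |y|))]

/-- The cross terms in the square cancel when all row sums vanish. -/
lemma sum_sq_alternating_eq {ι : Type*} [Fintype ι] (d : ι → ι → ℝ)
    (hsymm : ∀ i j, d i j = d j i) (hrow : ∀ i, ∑ j, d i j = 0) (i k : ι) :
    ∑ j, ∑ l, (d i k + d j l - (d i j + d k l)) ^ 2 =
      ∑ j, ∑ l, (d i k ^ 2 + d j l ^ 2 + d i j ^ 2 + d k l ^ 2) := by
  have hcol (l : ι) : ∑ j, d j l = 0 := by
    simpa only [hsymm _ l] using hrow l
  have hexpand (j l : ι) : (d i k + d j l - (d i j + d k l)) ^ 2 =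
      (d i k ^ 2 + d j l ^ 2 + d i j ^ 2 + d k l ^ 2) +
        ((2 * d i k - 2 * d i j) * d j l + (2 * d i j - 2 * d i k) * d k l -
          2 * d i k * d i j) - 2 * (d k l * d j l) := by ring
  have hmixed : ∑ j, ∑ l, d k l * d j l = 0 := by
    rw [sum_comm]
    simp [← mul_sum, hcol]
  have hcross : ∑ j, ∑ l, ((2 * d i k - 2 * d i j) * d j l +
      (2 * d i j - 2 * d i k) * d k l - 2 * d i k * d i j) = 0 := by
    simp [sum_add_distrib, sum_sub_distrib, ← mul_sum, hrow]
  simp only [hexpand]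
  simp only [sum_add_distrib, sum_sub_distrib, ← mul_sum] at hcross hmixed ⊢
  linarith

/-- The weighted square sum over all quadruples is at most `4 |ι|²` times the cubic sum. -/
lemma sum_abs_mul_sq_le {ι : Type*} [Fintype ι] (d : ι → ι → ℝ)
    (hsymm : ∀ i j, d i j = d j i) (hrow : ∀ i, ∑ j, d i j = 0) :
    ∑ i, ∑ k, ∑ j, ∑ l, |d i k| * (d i k + d j l - (d i j + d k l)) ^ 2 ≤
      4 * (Fintype.card ι : ℝ) ^ 2 * ∑ i, ∑ j, |d i j| ^ 3 := by
  calc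
    _ = ∑ i, ∑ k, ∑ j, ∑ l, |d i k| * (d i k ^ 2 + d j l ^ 2 + d i j ^ 2 + d k l ^ 2) := by
      simp only [← mul_sum, sum_sq_alternating_eq d hsymm hrow]
    _ ≤ ∑ i, ∑ k, ∑ j, ∑ l, (2 * |d i k| ^ 3 +
        2 / 3 * |d j l| ^ 3 + 2 / 3 * |d i j| ^ 3 + 2 / 3 * |d k l| ^ 3) := by
      gcongr with i _ k _ j _ l _
      have hik : |d i k| * d i k ^ 2 = |d i k| ^ 3 := by
        rw [← sq_abs (d i k)]
        ring
      linarith [abs_mul_sq_le_cubes (d i k) (d j l), abs_mul_sq_le_cubes (d i k) (d i j),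
        abs_mul_sq_le_cubes (d i k) (d k l)]
    _ = _ := by
      simp only [sum_add_distrib, ← mul_sum, sum_const, card_univ, nsmul_eq_mul]
      ring

/-- The moment bound `c_n Σ_{|{i,j,k,l}|=4} |d_{ik}| [d_{ik}+d_{jl}−(d_{ij}+d_{kl})]²
≤ 4 β_D / n` for a standardized array, `n ≥ 9`. -/
theorem weighted_square_bias_sum_bound (n : ℕ) (hn : Even n) (hn9 : 9 ≤ n)
    (d : Fin n → Fin n → ℝ)
    (hsymm : ∀ i j, d i j = d j i) (hdiag : ∀ i, d i i = 0)
    (hrow : ∀ i, ∑ j, d i j = 0)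
    (hvar : 2 * ((n : ℝ) - 2) / (((n : ℝ) - 1) * ((n : ℝ) - 3)) *
      (∑ i, ∑ j, d i j ^ 2) = 1)
    (βD : ℝ) (hβD : βD = ∑ i, ∑ j, if i ≠ j then |d i j| ^ 3 else 0) :
    1 / (2 * ((n : ℝ) - 1) ^ 2 * ((n : ℝ) - 3)) *
      (∑ i, ∑ j, ∑ k, ∑ l, if [i, j, k, l].Nodup then
        |d i k| * (d i k + d j l - (d i j + d k l)) ^ 2 else 0) ≤
    4 * βD / n := by
  have hβ : βD = ∑ i, ∑ j, |d i j| ^ 3 := by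
    rw [hβD]
    refine sum_congr rfl fun i _ => sum_congr rfl fun j _ => ?_
    by_cases h : i = j
    · simp [h, hdiag]
    · simp [h]
  have hβ_nonneg : 0 ≤ βD := by
    rw [hβ]
    positivity
  have hsum : (∑ i, ∑ j, ∑ k, ∑ l, if [i, j, k, l].Nodup then
      |d i k| * (d i k + d j l - (d i j + d k l)) ^ 2 else 0) ≤ 4 * (n : ℝ) ^ 2 * βD := by
    calc
      _ ≤ ∑ i, ∑ j, ∑ k, ∑ l, |d i k| * (d i k + d j l - (d i j + d k l)) ^ 2 := by
        gcongr with i _ j _ k _ l _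
        split_ifs
        · rfl
        · positivity
      _ = ∑ i, ∑ k, ∑ j, ∑ l, |d i k| * (d i k + d j l - (d i j + d k l)) ^ 2 :=
        sum_congr rfl fun i _ => sum_comm
      _ ≤ _ := by
        simpa [hβ] using sum_abs_mul_sq_le d hsymm hrow
  have hn' : (9 : ℝ) ≤ n := by exact_mod_cast hn9
  have hcubic : (n : ℝ) ^ 3 ≤ 2 * (n - 1) ^ 2 * (n - 3) := by
    nlinarith [mul_nonneg (sq_nonneg (n : ℝ)) (sub_nonneg.mpr hn')]
  have hden : 0 < 2 * ((n : ℝ) - 1) ^ 2 * (n - 3) :=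
    mul_pos (mul_pos two_pos (pow_pos (by linarith) 2)) (by linarith)
  rw [one_div_mul_eq_div, div_le_div_iff₀ hden (by linarith)]
  calc
    _ ≤ 4 * (n : ℝ) ^ 2 * βD * n := by gcongr
    _ = 4 * βD * (n : ℝ) ^ 3 := by ring
    _ ≤ _ := by gcongr
end

section
/- Let n ≥ 9 be even and D = (d_{ij}) a standardized n×n array, and let c_n = 1/(2(n−1)²(n−3)). Then for any fixed choice of coordinate ι among the four quadruple-coordinates i, j, k, l: (a) c_n · Σ_{(i,j,k,l,s): i,j,k,l,s distinct} |d_{ιs}| · [d_{ik} + d_{jl} − (d_{ij} + d_{kl})]² ≤ 4 β_D; and (b) c_n · Σ_{(i,j,k,l,s,t): i,j,k,l,s,t distinct} |d_{st}| · [d_{ik} + d_{jl} − (d_{ij} + d_{kl})]² ≤ 4 n β_D. -/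
open Finset

section EmbeddingSums

variable {α : Type*} [Fintype α]

theorem sum_fin_succ_fun {m : ℕ} (G : (Fin (m + 1) → α) → ℝ) :
    ∑ f, G f = ∑ x, ∑ g : Fin m → α, G (Matrix.vecCons x g) := by
  rw [← (Fin.consEquiv fun _ : Fin (m + 1) => α).sum_comp, Fintype.sum_prod_type]
  rfl

theorem sum_embedding_eq_sum_nodup [DecidableEq α] {m : ℕ} (G : (Fin m → α) → ℝ) :
    ∑ f : Fin m ↪ α, G f = ∑ f : Fin m → α, if (List.ofFn f).Nodup then G f else 0 := by
  classical
  rw [← (Equiv.subtypeInjectiveEquivEmbedding (Fin m) α).sum_comp, ← Finset.sum_filter]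
  exact (Finset.sum_subtype _ (fun f => by simp [List.nodup_ofFn]) G).symm

theorem sum_embedding_perm {m : ℕ} (σ : Equiv.Perm (Fin m)) (G : (Fin m → α) → ℝ) :
    ∑ f : Fin m ↪ α, G (f ∘ σ) = ∑ f : Fin m ↪ α, G f :=
  Fintype.sum_equiv (σ.symm.embeddingCongr (Equiv.refl α)) _ _ fun _ => rfl

theorem sum_embedding_succ {m : ℕ} (G : α → (Fin m → α) → ℝ) :
    ∑ f : Fin (m + 1) ↪ α, G (f 0) (f ∘ Fin.succ) =
      ∑ g : Fin m ↪ α, (∑ x, G x g - ∑ b, G (g b) g) := by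
  classical
  rw [Fintype.sum_equiv (Equiv.embeddingFinSucc m α) (fun f => G (f 0) (f ∘ Fin.succ))
    (fun p => G p.2.1 p.1) (fun _ => rfl), Fintype.sum_sigma]
  refine Finset.sum_congr rfl fun g _ => ?_
  rw [eq_sub_iff_add_eq, ← Finset.sum_map univ g fun x => G x g,
    ← Finset.sum_compl_add_sum (univ.map g)]
  congr 1
  exact (Finset.sum_subtype _ (fun x => by simp) fun x => G x g).symm

theorem sum_embedding_pair {m : ℕ} (g : α → α → ℝ) {a b : Fin (m + 2)} (hab : a ≠ b) :
    ∑ f : Fin (m + 2) ↪ α, g (f a) (f b) = ∑ f : Fin (m + 2) ↪ α, g (f 0) (f 1) := by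
  have hb : (0 : Fin (m + 2)) ≠ Equiv.swap 0 a b := by
    rw [Ne, eq_comm, Equiv.swap_apply_eq_iff, Equiv.swap_apply_left]
    exact hab.symm
  rw [← sum_embedding_perm (Equiv.swap 0 a * Equiv.swap 1 (Equiv.swap 0 a b))
    fun f => g (f 0) (f 1)]
  simp [Equiv.swap_apply_of_ne_of_ne (Fin.zero_ne_one) hb]

theorem sum_embedding_pair_succ {m : ℕ} (g : α → α → ℝ) :
    ∑ f : Fin (m + 3) ↪ α, g (f 0) (f 1) =
      ((Fintype.card α : ℝ) - (m + 2)) * ∑ f : Fin (m + 2) ↪ α, g (f 0) (f 1) := by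
  have h : (Fin.succ 0 : Fin (m + 3)) ≠ Fin.succ 1 :=
    (Fin.succ_injective _).ne Fin.zero_ne_one
  rw [← sum_embedding_pair g h, Finset.mul_sum]
  refine (sum_embedding_succ (m := m + 2) fun _ f => g (f 0) (f 1)).trans ?_
  refine Finset.sum_congr rfl fun f _ => ?_
  simp
  ring

end EmbeddingSums

section ArraySums

variable {α : Type*} [Fintype α] {d : α → α → ℝ}

/-- The sum of `|d x₀ x₁| ^ 3` over tuples of `m + 2` distinct indices. -/
noncomputable def embeddingCubeSum (d : α → α → ℝ) (m : ℕ) : ℝ :=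
  ∑ f : Fin (m + 2) ↪ α, |d (f 0) (f 1)| ^ 3

theorem mul_mul_le_sum_cubes_div {x y z : ℝ} (hx : 0 ≤ x) (hy : 0 ≤ y) (hz : 0 ≤ z) :
    x * y * z ≤ (x ^ 3 + y ^ 3 + z ^ 3) / 3 := by
  nlinarith [mul_nonneg (add_nonneg (add_nonneg hx hy) hz)
    (add_nonneg (add_nonneg (sq_nonneg (x - y)) (sq_nonneg (y - z))) (sq_nonneg (z - x)))]

theorem embeddingCubeSum_nonneg (m : ℕ) : 0 ≤ embeddingCubeSum d m :=
  Finset.sum_nonneg fun _ _ => by positivity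

theorem embeddingCubeSum_succ (m : ℕ) :
    embeddingCubeSum d (m + 1) = ((Fintype.card α : ℝ) - (m + 2)) * embeddingCubeSum d m :=
  sum_embedding_pair_succ fun x y => |d x y| ^ 3

theorem sum_cube_le_embeddingCubeSum (hdiag : ∀ x, d x x = 0) {m : ℕ} (a b : Fin (m + 2)) :
    ∑ f : Fin (m + 2) ↪ α, |d (f a) (f b)| ^ 3 ≤ embeddingCubeSum d m := by
  obtain rfl | hab := eq_or_ne a b
  · simpa [hdiag] using embeddingCubeSum_nonneg (d := d) m
  · exact (sum_embedding_pair (fun x y => |d x y| ^ 3) hab).le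

theorem sum_triple_le_embeddingCubeSum (hdiag : ∀ x, d x x = 0) {m : ℕ}
    (a b c e p q : Fin (m + 2)) :
    ∑ f : Fin (m + 2) ↪ α, |d (f a) (f b)| * |d (f c) (f e)| * |d (f p) (f q)| ≤
      embeddingCubeSum d m := by
  calc
    _ ≤ ∑ f : Fin (m + 2) ↪ α,
        (|d (f a) (f b)| ^ 3 + |d (f c) (f e)| ^ 3 + |d (f p) (f q)| ^ 3) / 3 :=
      Finset.sum_le_sum fun f _ =>
        mul_mul_le_sum_cubes_div (abs_nonneg _) (abs_nonneg _) (abs_nonneg _)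
    _ ≤ _ := by
      rw [← Finset.sum_div, Finset.sum_add_distrib, Finset.sum_add_distrib]
      linarith [sum_cube_le_embeddingCubeSum hdiag a b, sum_cube_le_embeddingCubeSum hdiag c e,
        sum_cube_le_embeddingCubeSum hdiag p q]

theorem sum_weighted_sq_le (hdiag : ∀ x, d x x = 0) {m : ℕ} (u v a b : Fin (m + 2)) :
    ∑ f : Fin (m + 2) ↪ α, |d (f u) (f v)| * d (f a) (f b) ^ 2 ≤ embeddingCubeSum d m := by
  refine le_of_eq_of_le (Finset.sum_congr rfl fun f _ => ?_)
    (sum_triple_le_embeddingCubeSum hdiag u v a b a b)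
  rw [mul_assoc, abs_mul_abs_self, sq]

theorem abs_sum_weighted_cross_succ_le (hdiag : ∀ x, d x x = 0) (hrow : ∀ x, ∑ y, d x y = 0)
    {m : ℕ} (u v a b c : Fin (m + 2)) :
    |∑ f : Fin (m + 3) ↪ α, |d (f u.succ) (f v.succ)| *
        (d (f a.succ) (f b.succ) * d (f c.succ) (f 0))| ≤
      (m + 1) * embeddingCubeSum d m := by
  have h := sum_embedding_succ (α := α) (m := m + 2)
    fun x f => |d (f u) (f v)| * (d (f a) (f b) * d (f c) x)
  simp only [Function.comp_apply] at h
  rw [h]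
  have h' : ∀ g : Fin (m + 2) ↪ α,
      ∑ x, |d (g u) (g v)| * (d (g a) (g b) * d (g c) x) = 0 := fun g => by
    simp_rw [← Finset.mul_sum, hrow, mul_zero]
  simp_rw [h', zero_sub]
  rw [Finset.sum_neg_distrib, abs_neg, Finset.sum_comm,
    ← Finset.sum_erase_add _ _ (Finset.mem_univ c)]
  simp only [hdiag, mul_zero, Finset.sum_const_zero, add_zero]
  refine (Finset.abs_sum_le_sum_abs _ _).trans
    ((Finset.sum_le_card_nsmul _ _ (embeddingCubeSum d m) fun e _ => ?_).trans_eq ?_)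
  · refine (Finset.abs_sum_le_sum_abs _ _).trans
      (le_of_eq_of_le (Finset.sum_congr rfl fun f _ => ?_)
        (sum_triple_le_embeddingCubeSum hdiag u v a b c e))
    rw [abs_mul, abs_mul, abs_abs, mul_assoc]
  · rw [Finset.card_erase_of_mem (Finset.mem_univ c)]
    simp

theorem abs_sum_weighted_cross_le (hdiag : ∀ x, d x x = 0) (hrow : ∀ x, ∑ y, d x y = 0)
    {m : ℕ} {u v a b c e : Fin (m + 3)} (hu : u ≠ e) (hv : v ≠ e) (ha : a ≠ e) (hb : b ≠ e)
    (hc : c ≠ e) :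
    |∑ f : Fin (m + 3) ↪ α, |d (f u) (f v)| * (d (f a) (f b) * d (f c) (f e))| ≤
      (m + 1) * embeddingCubeSum d m := by
  have key : ∀ x : Fin (m + 3), x ≠ e → ∃ y : Fin (m + 2), Equiv.swap 0 e x = y.succ := by
    intro x hx
    obtain ⟨y, hy⟩ := Fin.exists_succ_eq.2 (show Equiv.swap 0 e x ≠ 0 by
      rwa [Ne, Equiv.swap_apply_eq_iff, Equiv.swap_apply_left])
    exact ⟨y, hy.symm⟩
  obtain ⟨u', hu⟩ := key u hu
  obtain ⟨v', hv⟩ := key v hv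
  obtain ⟨a', ha⟩ := key a ha
  obtain ⟨b', hb⟩ := key b hb
  obtain ⟨c', hc⟩ := key c hc
  rw [← sum_embedding_perm (Equiv.swap 0 e)
    fun f => |d (f u) (f v)| * (d (f a) (f b) * d (f c) (f e))]
  simp only [Function.comp_apply, hu, hv, ha, hb, hc, Equiv.swap_apply_right]
  exact abs_sum_weighted_cross_succ_le hdiag hrow u' v' a' b' c'

theorem sum_weighted_four_cycle_le (hsymm : ∀ x y, d x y = d y x) (hdiag : ∀ x, d x x = 0)
    (hrow : ∀ x, ∑ y, d x y = 0) {m : ℕ} {i j k l u v : Fin (m + 3)}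
    (hijkl : [i, j, k, l].Nodup) (hu : u ∉ [j, k, l]) (hv : v ∉ [j, k, l]) :
    ∑ f : Fin (m + 3) ↪ α, |d (f u) (f v)| *
        (d (f i) (f k) + d (f j) (f l) - (d (f i) (f j) + d (f k) (f l))) ^ 2 ≤
      4 * embeddingCubeSum d (m + 1) + 12 * ((m + 1) * embeddingCubeSum d m) := by
  simp only [List.nodup_cons, List.mem_cons, List.not_mem_nil, or_false, not_or] at hijkl hu hv
  obtain ⟨⟨hij, hik, hil⟩, ⟨hjk, hjl⟩, hkl, -⟩ := hijkl
  obtain ⟨huj, huk, hul⟩ := hu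
  obtain ⟨hvj, hvk, hvl⟩ := hv
  have cross {a b c e : Fin (m + 3)} := @abs_sum_weighted_cross_le α _ d hdiag hrow m u v a b c e
  have h₁ := abs_le.1 (cross hul hvl hil hkl hjl)
  have h₂ := abs_le.1 (cross hul hvl hil hjl hkl)
  have h₃ := abs_le.1 (cross huj hvj hij (Ne.symm hjk) hij)
  have h₄ := abs_le.1 (cross hul hvl hil hkl hkl)
  have h₅ := abs_le.1 (cross hul hvl hil hjl hjl)
  have h₆ := abs_le.1 (cross huk hvk hjk (Ne.symm hkl) (Ne.symm hkl))
  have s₁ := sum_weighted_sq_le (m := m + 1) hdiag u v i k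
  have s₂ := sum_weighted_sq_le (m := m + 1) hdiag u v j l
  have s₃ := sum_weighted_sq_le (m := m + 1) hdiag u v i j
  have s₄ := sum_weighted_sq_le (m := m + 1) hdiag u v k l
  have expand : ∀ f : Fin (m + 3) ↪ α, |d (f u) (f v)| *
        (d (f i) (f k) + d (f j) (f l) - (d (f i) (f j) + d (f k) (f l))) ^ 2 =
      |d (f u) (f v)| * d (f i) (f k) ^ 2 + |d (f u) (f v)| * d (f j) (f l) ^ 2 +
      |d (f u) (f v)| * d (f i) (f j) ^ 2 + |d (f u) (f v)| * d (f k) (f l) ^ 2 +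
      2 * (|d (f u) (f v)| * (d (f i) (f k) * d (f j) (f l))) +
      2 * (|d (f u) (f v)| * (d (f i) (f j) * d (f k) (f l))) -
      2 * (|d (f u) (f v)| * (d (f i) (f k) * d (f i) (f j))) -
      2 * (|d (f u) (f v)| * (d (f i) (f k) * d (f k) (f l))) -
      2 * (|d (f u) (f v)| * (d (f i) (f j) * d (f j) (f l))) -
      2 * (|d (f u) (f v)| * (d (f j) (f l) * d (f l) (f k))) := fun f => by
    rw [hsymm (f l) (f k)]
    ring
  simp_rw [expand, Finset.sum_sub_distrib, Finset.sum_add_distrib, ← Finset.mul_sum]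
  linarith [h₁.1, h₁.2, h₂.1, h₂.2, h₃.1, h₃.2, h₄.1, h₄.2, h₅.1, h₅.2, h₆.1, h₆.2]

theorem embeddingCubeSum_zero [DecidableEq α] :
    embeddingCubeSum d 0 = ∑ i, ∑ j, if i ≠ j then |d i j| ^ 3 else 0 := by
  unfold embeddingCubeSum
  rw [sum_embedding_eq_sum_nodup fun f => |d (f 0) (f 1)| ^ 3]
  simp [sum_fin_succ_fun]

end ArraySums

/-- The moment bounds over tuples of distinct indices: for any coordinate `ι` among
`i,j,k,l`, `c_n Σ_{|{i,j,k,l,s}|=5} |d_{ιs}| [d_{ik}+d_{jl}−(d_{ij}+d_{kl})]² ≤ 4 β_D`, and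
`c_n Σ_{|{i,j,k,l,s,t}|=6} |d_{st}| [d_{ik}+d_{jl}−(d_{ij}+d_{kl})]² ≤ 4 n β_D`. -/
theorem weighted_sum_bounds_five_six (n : ℕ) (hn : Even n) (hn9 : 9 ≤ n)
    (d : Fin n → Fin n → ℝ)
    (hsymm : ∀ i j, d i j = d j i) (hdiag : ∀ i, d i i = 0)
    (hrow : ∀ i, ∑ j, d i j = 0)
    (hvar : 2 * ((n : ℝ) - 2) / (((n : ℝ) - 1) * ((n : ℝ) - 3)) *
      (∑ i, ∑ j, d i j ^ 2) = 1)
    (βD : ℝ) (hβD : βD = ∑ i, ∑ j, if i ≠ j then |d i j| ^ 3 else 0) :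
    (∀ ι : Fin 4,
      1 / (2 * ((n : ℝ) - 1) ^ 2 * ((n : ℝ) - 3)) *
        (∑ i, ∑ j, ∑ k, ∑ l, ∑ s, if [i, j, k, l, s].Nodup then
          |d (![i, j, k, l] ι) s| * (d i k + d j l - (d i j + d k l)) ^ 2 else 0) ≤
      4 * βD) ∧
    1 / (2 * ((n : ℝ) - 1) ^ 2 * ((n : ℝ) - 3)) *
      (∑ i, ∑ j, ∑ k, ∑ l, ∑ s, ∑ t, if [i, j, k, l, s, t].Nodup then
        |d s t| * (d i k + d j l - (d i j + d k l)) ^ 2 else 0) ≤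
    4 * (n : ℝ) * βD := by
  have hn' : (9 : ℝ) ≤ n := by exact_mod_cast hn9
  have hpos : 0 < 2 * ((n : ℝ) - 1) ^ 2 * ((n : ℝ) - 3) := by
    have : 0 < (n : ℝ) - 1 := by linarith
    have : 0 < (n : ℝ) - 3 := by linarith
    positivity
  have hβ : embeddingCubeSum d 0 = βD := by rw [embeddingCubeSum_zero, hβD]
  have hβ0 : 0 ≤ βD := hβ ▸ embeddingCubeSum_nonneg 0
  have h₁ := embeddingCubeSum_succ (d := d) 0
  have h₂ := embeddingCubeSum_succ (d := d) 1
  have h₃ := embeddingCubeSum_succ (d := d) 2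
  have h₄ := embeddingCubeSum_succ (d := d) 3
  norm_num [hβ] at h₁ h₂ h₃ h₄
  rw [h₁] at h₂
  rw [h₂] at h₃
  rw [h₃] at h₄
  have five : 4 * embeddingCubeSum d 3 + 12 * ((2 + 1) * embeddingCubeSum d 2) ≤
      4 * βD * (2 * ((n : ℝ) - 1) ^ 2 * ((n : ℝ) - 3)) := by
    rw [h₃, h₂, ← sub_nonneg]
    obtain ⟨t, ht, ht'⟩ : ∃ t : ℝ, 0 ≤ t ∧ (n : ℝ) = t + 9 := ⟨n - 9, by linarith, by ring⟩
    rw [ht']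
    ring_nf
    positivity
  have six : 4 * embeddingCubeSum d 4 + 12 * ((3 + 1) * embeddingCubeSum d 3) ≤
      4 * n * βD * (2 * ((n : ℝ) - 1) ^ 2 * ((n : ℝ) - 3)) := by
    rw [h₄, h₃, ← sub_nonneg]
    obtain ⟨t, ht, ht'⟩ : ∃ t : ℝ, 0 ≤ t ∧ (n : ℝ) = t + 9 := ⟨n - 9, by linarith, by ring⟩
    rw [ht']
    ring_nf
    positivity
  constructor
  · intro ι
    rw [one_div_mul_eq_div, div_le_iff₀ hpos]
    have h : ∑ f : Fin 5 ↪ Fin n, |d (f (![0, 1, 2, 3] ι)) (f 4)| *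
        (d (f 0) (f 2) + d (f 1) (f 3) - (d (f 0) (f 1) + d (f 2) (f 3))) ^ 2 ≤
        4 * embeddingCubeSum d 3 + 12 * ((2 + 1) * embeddingCubeSum d 2) := by
      have cycle {i j k l u v : Fin 5} :=
        @sum_weighted_four_cycle_le _ _ d hsymm hdiag hrow 2 i j k l u v
      fin_cases ι
      · exact cycle (by decide) (by decide) (by decide)
      · refine le_of_eq_of_le (Finset.sum_congr rfl fun f _ => ?_)
          (cycle (i := 1) (j := 0) (k := 3) (l := 2) (u := 1) (v := 4)
            (by decide) (by decide) (by decide))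
        rw [hsymm (f 1) (f 0), hsymm (f 3) (f 2), add_comm (d (f 1) (f 3))]
        rfl
      · refine le_of_eq_of_le (Finset.sum_congr rfl fun f _ => ?_)
          (cycle (i := 2) (j := 3) (k := 0) (l := 1) (u := 2) (v := 4)
            (by decide) (by decide) (by decide))
        rw [hsymm (f 2) (f 0), hsymm (f 3) (f 1), add_comm (d (f 2) (f 3))]
        rfl
      · refine le_of_eq_of_le (Finset.sum_congr rfl fun f _ => ?_)
          (cycle (i := 3) (j := 2) (k := 1) (l := 0) (u := 3) (v := 4)
            (by decide) (by decide) (by decide))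
        rw [hsymm (f 3) (f 1), hsymm (f 2) (f 0), hsymm (f 3) (f 2), hsymm (f 1) (f 0),
          add_comm (d (f 1) (f 3)), add_comm (d (f 2) (f 3))]
        rfl
    rw [sum_embedding_eq_sum_nodup fun f => |d (f (![0, 1, 2, 3] ι)) (f 4)| *
      (d (f 0) (f 2) + d (f 1) (f 3) - (d (f 0) (f 1) + d (f 2) (f 3))) ^ 2] at h
    simp only [sum_fin_succ_fun, Fintype.sum_unique] at h
    refine le_of_eq_of_le ?_ (h.trans five)
    fin_cases ι <;> rfl
  · rw [one_div_mul_eq_div, div_le_iff₀ hpos]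
    have h := sum_weighted_four_cycle_le (m := 3) hsymm hdiag hrow (i := 0) (j := 1) (k := 2)
      (l := 3) (u := 4) (v := 5) (by decide) (by decide) (by decide)
    rw [sum_embedding_eq_sum_nodup fun f => |d (f 4) (f 5)| *
      (d (f 0) (f 2) + d (f 1) (f 3) - (d (f 0) (f 1) + d (f 2) (f 3))) ^ 2] at h
    simp only [sum_fin_succ_fun, Fintype.sum_unique] at h
    exact h.trans (by exact_mod_cast six)
end

section
/- Let n ≥ 1000 be even and D = (d_{ij}) a standardized n×n array with β_D ≤ n/90. Define the truncated array D′ by d′_{ij} = d_{ij} · 1(|d_{ij}| ≤ 1/2). Then: |d′_{++}| ≤ 4 β_D; |d′_{i+}| ≤ 4 Σ_j |d_{ij}|³ ≤ 4 β_D for every i; |μ_{D′}| ≤ 8 β_D / n; |σ²_{D′} − 1| ≤ 10 β_D / n; and β_{D′} ≤ 22 β_D. -/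
open Finset

lemma abs_add_four_pow_three_le (a b c e : ℝ) :
    |a - b - c + e| ^ 3 ≤ 16 * (|a| ^ 3 + |b| ^ 3 + |c| ^ 3 + |e| ^ 3) := by
  have key : ∀ x y : ℝ, 0 ≤ x → 0 ≤ y → (x + y) ^ 3 ≤ 4 * (x ^ 3 + y ^ 3) := by
    intro x y hx hy
    nlinarith [mul_nonneg (add_nonneg hx hy) (sq_nonneg (x - y))]
  have h1 : |a - b - c + e| ≤ (|a| + |b|) + (|c| + |e|) := by
    have h2 := abs_add_le (a - b - c) e
    have h3 := abs_sub (a - b) c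
    have h4 := abs_sub a b
    linarith
  have h5 := pow_le_pow_left₀ (abs_nonneg _) h1 3
  have h6 := key (|a| + |b|) (|c| + |e|) (by positivity) (by positivity)
  have h7 := key |a| |b| (abs_nonneg _) (abs_nonneg _)
  have h8 := key |c| |e| (abs_nonneg _) (abs_nonneg _)
  linarith

lemma abs_sub_truncation_le (x : ℝ) :
    |x - if |x| ≤ 1 / 2 then x else 0| ≤ 4 * |x| ^ 3 := by
  split_ifs with h
  · simp
  · push Not at h
    rw [sub_zero]
    nlinarith [abs_nonneg x, mul_nonneg (abs_nonneg x)
      (mul_nonneg (sub_nonneg.2 h.le) (by positivity : 0 ≤ |x| + 1 / 2))]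

lemma sq_sub_truncation_sq_mem (x : ℝ) :
    0 ≤ x ^ 2 - (if |x| ≤ 1 / 2 then x else 0) ^ 2 ∧
      x ^ 2 - (if |x| ≤ 1 / 2 then x else 0) ^ 2 ≤ 2 * |x| ^ 3 := by
  split_ifs with h
  · simp
  · push Not at h
    refine ⟨by simpa using sq_nonneg x, ?_⟩
    rw [← sq_abs x]
    nlinarith [mul_nonneg (sq_nonneg |x|) (sub_nonneg.2 h.le)]

lemma abs_truncation_le (x : ℝ) : |if |x| ≤ 1 / 2 then x else 0| ≤ |x| := by
  split_ifs <;> simp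

lemma sum_abs_pow_succ_le {ι : Type*} (s : Finset ι) (r : ι → ℝ) (C : ℝ)
    (h : ∑ i ∈ s, |r i| ≤ C) (k : ℕ) : ∑ i ∈ s, |r i| ^ (k + 1) ≤ C ^ (k + 1) := by
  have hC : 0 ≤ C := (sum_nonneg fun i _ => abs_nonneg (r i)).trans h
  calc ∑ i ∈ s, |r i| ^ (k + 1) ≤ ∑ i ∈ s, C ^ k * |r i| := by
        refine sum_le_sum fun i hi => ?_
        rw [pow_succ]
        have hi' : |r i| ≤ C :=
          (single_le_sum (f := fun i => |r i|) (fun j _ => abs_nonneg (r j)) hi).trans h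
        gcongr
    _ = C ^ k * ∑ i ∈ s, |r i| := by rw [mul_sum]
    _ ≤ C ^ k * C := by gcongr
    _ = C ^ (k + 1) := (pow_succ C k).symm

lemma abs_variance_sub_one_le {x β S S' T Q : ℝ} (hx : 1000 ≤ x) (hβ : 0 ≤ β)
    (hβx : β ≤ x / 90) (hS : 2 * (x - 2) / ((x - 1) * (x - 3)) * S = 1)
    (hS1 : 0 ≤ S - S') (hS2 : S - S' ≤ 2 * β) (hT : |T| ≤ 4 * β)
    (hQ0 : 0 ≤ Q) (hQ : Q ≤ (4 * β) ^ 2) :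
    |2 / ((x - 1) * (x - 3)) * ((x - 2) * S' + T ^ 2 / (x - 1) - 2 * Q) - 1| ≤ 10 * β / x := by
  have h1 : 0 < x - 1 := by linarith
  have h3 : 0 < x - 3 := by linarith
  have hT2 : T ^ 2 ≤ (4 * β) ^ 2 := sq_le_sq' (abs_le.1 hT).1 (abs_le.1 hT).2
  have hTd : T ^ 2 / (x - 1) ≤ β ^ 2 := by
    rw [div_le_iff₀ h1]
    nlinarith [sq_nonneg β]
  have hTd0 : 0 ≤ T ^ 2 / (x - 1) := by positivity
  have hβ2 : β ^ 2 ≤ x / 90 * β := by nlinarith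
  have heq : 2 / ((x - 1) * (x - 3)) * ((x - 2) * S' + T ^ 2 / (x - 1) - 2 * Q) - 1
      = 2 / ((x - 1) * (x - 3)) * (-((x - 2) * (S - S')) + T ^ 2 / (x - 1) - 2 * Q) := by
    linear_combination hS
  have hE : |-((x - 2) * (S - S')) + T ^ 2 / (x - 1) - 2 * Q| ≤ 12 / 5 * (x * β) := by
    have hxS : (x - 2) * (S - S') ≤ (x - 2) * (2 * β) :=
      mul_le_mul_of_nonneg_left hS2 (by linarith)
    have hxS0 : 0 ≤ (x - 2) * (S - S') := mul_nonneg (by linarith) hS1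
    have hxβ : 0 ≤ x * β := mul_nonneg (by linarith) hβ
    rw [abs_le]
    constructor <;> nlinarith
  rw [heq, abs_mul, abs_of_nonneg (by positivity)]
  calc 2 / ((x - 1) * (x - 3)) * |-((x - 2) * (S - S')) + T ^ 2 / (x - 1) - 2 * Q|
      ≤ 2 / ((x - 1) * (x - 3)) * (12 / 5 * (x * β)) := by gcongr
    _ ≤ 10 * β / x := by
        rw [div_mul_eq_mul_div, div_le_div_iff₀ (by positivity) (by linarith)]
        have : 0 ≤ β * (10 * ((x - 1) * (x - 3)) - 24 / 5 * x ^ 2) :=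
          mul_nonneg hβ (by nlinarith)
        linarith

lemma cubic_remainder_le {x β T R : ℝ} (hx : 1000 ≤ x) (hβ : 0 ≤ β)
    (hβx : β ≤ x / 90) (hT : |T| ≤ 4 * β) (hR : R ≤ (4 * β) ^ 3) :
    16 * (β + x * (R / (x - 2) ^ 3) + x * (R / (x - 2) ^ 3)
      + x * (x * (|T| / ((x - 1) * (x - 2))) ^ 3)) ≤ 18 * β := by
  have hx0 : 0 < x := by linarith
  have h1 : 0 < x - 1 := by linarith
  have h2 : 0 < x - 2 := by linarith
  have hβ2 : β ^ 2 ≤ (x / 90) ^ 2 := by gcongr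
  have hrow : x * (R / (x - 2) ^ 3) ≤ β / 100 := by
    have hR' : R ≤ 64 / 8100 * x ^ 2 * β := by
      nlinarith [mul_le_mul_of_nonneg_right hβ2 hβ]
    have hcube : (99 / 100 : ℝ) * x ^ 3 ≤ (x - 2) ^ 3 := by
      have : 0 ≤ x ^ 2 * (x - 1000) := by nlinarith [sq_nonneg x]
      nlinarith
    rw [← mul_div_assoc, div_le_iff₀ (by positivity)]
    have h4 := mul_le_mul_of_nonneg_left hR' hx0.le
    have h5 := mul_le_mul_of_nonneg_left hcube hβ
    have h6 : 0 ≤ x ^ 3 * β := by positivity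
    linarith
  have htot : x * (x * (|T| / ((x - 1) * (x - 2))) ^ 3) ≤ β / 1000 := by
    set t := |T| / ((x - 1) * (x - 2)) with ht
    have ht0 : 0 ≤ t := by positivity
    have ht1 : t * x ^ 2 ≤ 8 * β := by
      have : t * ((x - 1) * (x - 2)) = |T| := by
        rw [ht]
        field_simp
      have : t * (x ^ 2 / 2) ≤ t * ((x - 1) * (x - 2)) := by
        gcongr
        nlinarith
      linarith
    have htx : t * x ≤ 1 / 10 := by
      by_contra! h
      nlinarith
    have htβ : t * 100 ≤ β := by
      have : t * 1000000 ≤ t * x ^ 2 := by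
        gcongr
        nlinarith
      linarith
    have hsq : (t * x) ^ 2 ≤ (1 / 10) ^ 2 := by gcongr
    nlinarith [mul_le_mul_of_nonneg_right hsq ht0]
  linarith

/-- Properties of the truncated array `D′` with `d′_{ij} = d_{ij} 1(|d_{ij}| ≤ 1/2)`:
`|d′_{++}| ≤ 4β_D`, `|d′_{i+}| ≤ 4 Σ_j |d_{ij}|³ ≤ 4β_D`, `|μ_{D′}| ≤ 8β_D/n`,
`|σ²_{D′} − 1| ≤ 10β_D/n` and `β_{D′} ≤ 22β_D`. -/
theorem truncated_array_properties (n : ℕ) (hn : Even n) (hn1000 : 1000 ≤ n)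
    (d : Fin n → Fin n → ℝ)
    (hsymm : ∀ i j, d i j = d j i) (hdiag : ∀ i, d i i = 0)
    (hrow : ∀ i, ∑ j, d i j = 0)
    (hvar : 2 * ((n : ℝ) - 2) / (((n : ℝ) - 1) * ((n : ℝ) - 3)) *
      (∑ i, ∑ j, d i j ^ 2) = 1)
    (βD : ℝ) (hβD : βD = ∑ i, ∑ j, if i ≠ j then |d i j| ^ 3 else 0)
    (hβDn : βD ≤ (n : ℝ) / 90)
    (d' : Fin n → Fin n → ℝ)
    (hd' : ∀ i j, d' i j = if |d i j| ≤ 1 / 2 then d i j else 0)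
    (tot' : ℝ) (htot' : tot' = ∑ i, ∑ j, d' i j)
    (μ' : ℝ) (hμ' : μ' = tot' / ((n : ℝ) - 1))
    (σ'2 : ℝ)
    (hσ'2 : σ'2 = 2 / (((n : ℝ) - 1) * ((n : ℝ) - 3)) *
      (((n : ℝ) - 2) * (∑ i, ∑ j, d' i j ^ 2) + tot' ^ 2 / ((n : ℝ) - 1)
        - 2 * ∑ i, (∑ j, d' i j) ^ 2))
    (dhat' : Fin n → Fin n → ℝ)
    (hdhat' : ∀ i j, dhat' i j = if i = j then 0 else
      d' i j - (∑ a, d' i a) / ((n : ℝ) - 2) - (∑ a, d' a j) / ((n : ℝ) - 2)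
        + tot' / (((n : ℝ) - 1) * ((n : ℝ) - 2)))
    (β' : ℝ)
    (hβ' : β' = (∑ i, ∑ j, if i ≠ j then |dhat' i j| ^ 3 else 0) / Real.sqrt σ'2 ^ 3) :
    |tot'| ≤ 4 * βD ∧
    (∀ i, |∑ j, d' i j| ≤ 4 * ∑ j, |d i j| ^ 3 ∧ 4 * (∑ j, |d i j| ^ 3) ≤ 4 * βD) ∧
    |μ'| ≤ 8 * βD / n ∧
    |σ'2 - 1| ≤ 10 * βD / n ∧
    β' ≤ 22 * βD := by
  set x : ℝ := (n : ℝ) with hxdef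
  have hx : (1000 : ℝ) ≤ x := by
    rw [hxdef]
    exact_mod_cast hn1000
  have hx0 : 0 < x := by linarith
  have hβ : βD = ∑ i, ∑ j, |d i j| ^ 3 := by
    rw [hβD]
    refine sum_congr rfl fun i _ => sum_congr rfl fun j _ => ?_
    split_ifs with h
    · rfl
    · simp [not_not.1 h, hdiag]
  have hβ0 : 0 ≤ βD := by
    rw [hβ]
    positivity
  have hrowle : ∀ i, |∑ j, d' i j| ≤ 4 * ∑ j, |d i j| ^ 3 := by
    intro i
    have : ∑ j, d' i j = -∑ j, (d i j - d' i j) := by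
      rw [sum_sub_distrib, hrow]
      ring
    rw [this, abs_neg, mul_sum]
    refine (abs_sum_le_sum_abs _ _).trans (sum_le_sum fun j _ => ?_)
    rw [hd']
    exact abs_sub_truncation_le _
  have hrowβ : ∀ i, ∑ j, |d i j| ^ 3 ≤ βD := by
    intro i
    rw [hβ]
    exact single_le_sum (f := fun i => ∑ j, |d i j| ^ 3) (fun i _ => by positivity) (mem_univ i)
  have hsumrow : ∑ i, |∑ j, d' i j| ≤ 4 * βD := by
    rw [hβ, mul_sum]
    exact sum_le_sum fun i _ => hrowle i
  have htot : |tot'| ≤ 4 * βD := by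
    rw [htot']
    exact (abs_sum_le_sum_abs _ _).trans hsumrow
  have hμ : |μ'| ≤ 8 * βD / x := by
    rw [hμ', abs_div, abs_of_pos (by linarith : 0 < x - 1),
      div_le_div_iff₀ (by linarith) hx0]
    nlinarith [mul_le_mul_of_nonneg_right htot hx0.le]
  have hσ : |σ'2 - 1| ≤ 10 * βD / x := by
    rw [hσ'2]
    refine abs_variance_sub_one_le hx hβ0 hβDn hvar ?_ ?_ htot
      (sum_nonneg fun i _ => sq_nonneg _) ?_
    · simp only [← sum_sub_distrib, hd']
      exact sum_nonneg fun i _ => sum_nonneg fun j _ => (sq_sub_truncation_sq_mem _).1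
    · rw [hβ]
      simp only [← sum_sub_distrib, hd', mul_sum]
      exact sum_le_sum fun i _ => sum_le_sum fun j _ => (sq_sub_truncation_sq_mem _).2
    · simpa using sum_abs_pow_succ_le univ _ _ hsumrow 1
  refine ⟨htot, fun i => ⟨hrowle i, by linarith [hrowβ i]⟩, hμ, hσ, ?_⟩
  have hσlow : 8 / 9 ≤ σ'2 := by
    have : 10 * βD / x ≤ 1 / 9 := by
      rw [div_le_iff₀ hx0]
      linarith
    linarith [(abs_le.1 hσ).1]
  have hsqrt : 94 / 100 ≤ √σ'2 := Real.le_sqrt_of_sq_le (by linarith)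
  have hsqrt3 : (94 / 100) ^ 3 ≤ √σ'2 ^ 3 := by gcongr
  have hcol : ∀ j, ∑ a, d' a j = ∑ a, d' j a := fun j =>
    sum_congr rfl fun a _ => by rw [hd', hd', hsymm]
  have hentry : ∀ i j, (if i ≠ j then |dhat' i j| ^ 3 else 0) ≤
      16 * (|d i j| ^ 3 + |∑ a, d' i a| ^ 3 / (x - 2) ^ 3 + |∑ a, d' j a| ^ 3 / (x - 2) ^ 3
        + (|tot'| / ((x - 1) * (x - 2))) ^ 3) := by
    intro i j
    have h1 : 0 < x - 1 := by linarith
    have h2 : 0 < x - 2 := by linarith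
    have h3 : |d' i j| ≤ |d i j| := by
      rw [hd']
      exact abs_truncation_le _
    split_ifs with h
    · rw [hdhat', if_neg h, hcol]
      refine (abs_add_four_pow_three_le _ _ _ _).trans ?_
      rw [abs_div, abs_div, abs_div, abs_of_pos h2, abs_of_pos (mul_pos h1 h2), div_pow, div_pow]
      gcongr
    · positivity
  have hsum : (∑ i, ∑ j, if i ≠ j then |dhat' i j| ^ 3 else 0) ≤ 18 * βD := by
    refine (sum_le_sum fun i _ => sum_le_sum fun j _ => hentry i j).trans ?_
    refine le_trans (le_of_eq ?_) (cubic_remainder_le hx hβ0 hβDn htot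
      (sum_abs_pow_succ_le univ _ _ hsumrow 2))
    simp only [← mul_sum, sum_add_distrib, sum_const, card_univ, Fintype.card_fin, nsmul_eq_mul,
      ← sum_div, ← hβ, ← hxdef]
  rw [hβ', div_le_iff₀ (by positivity)]
  nlinarith [mul_le_mul_of_nonneg_left hsqrt3 hβ0]
end

section
/- Let n ≥ 1000 be even and D = (d_{ij}) a standardized n×n array with β_D ≤ n/90. Define the truncated array D′ by d′_{ij} = d_{ij} · 1(|d_{ij}| ≤ 1/2), and set d̃_{ij} = d̂′_{ij} / σ_{D′}. Then |d̃_{ij}| ≤ 1 for all i, j. -/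
open Finset

/-- Truncating `x` at level `1 / 2` changes its square by at most `2 * |x| ^ 3`. -/
lemma sq_sub_two_mul_abs_cube_le_sq_truncate (x : ℝ) :
    x ^ 2 - 2 * |x| ^ 3 ≤ (if |x| ≤ 1 / 2 then x else 0) ^ 2 := by
  split_ifs with h
  · linarith [pow_nonneg (abs_nonneg x) 3]
  · push Not at h
    rw [← sq_abs x]
    nlinarith [mul_nonneg (sq_nonneg |x|) (sub_nonneg.2 h.le)]

/-- Truncating `x` at level `1 / 2` moves it by at most `4 * |x| ^ 3`. -/
lemma abs_sub_truncate_le_four_mul_abs_cube (x : ℝ) :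
    |x - (if |x| ≤ 1 / 2 then x else 0)| ≤ 4 * |x| ^ 3 := by
  split_ifs with h
  · simp
  · push Not at h
    rw [sub_zero]
    nlinarith [mul_nonneg (abs_nonneg x) (mul_nonneg (sub_nonneg.2 h.le)
      (add_nonneg (abs_nonneg x) (by norm_num : (0 : ℝ) ≤ 1 / 2)))]

/-- The rescaled truncated array `d̃_{ij} = d̂′_{ij}/σ_{D′}` has all entries bounded by 1. -/
theorem truncated_rescaled_entries_le_one (n : ℕ) (hn : Even n) (hn1000 : 1000 ≤ n)
    (d : Fin n → Fin n → ℝ)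
    (hsymm : ∀ i j, d i j = d j i) (hdiag : ∀ i, d i i = 0)
    (hrow : ∀ i, ∑ j, d i j = 0)
    (hvar : 2 * ((n : ℝ) - 2) / (((n : ℝ) - 1) * ((n : ℝ) - 3)) *
      (∑ i, ∑ j, d i j ^ 2) = 1)
    (βD : ℝ) (hβD : βD = ∑ i, ∑ j, if i ≠ j then |d i j| ^ 3 else 0)
    (hβDn : βD ≤ (n : ℝ) / 90)
    (d' : Fin n → Fin n → ℝ)
    (hd' : ∀ i j, d' i j = if |d i j| ≤ 1 / 2 then d i j else 0)
    (tot' : ℝ) (htot' : tot' = ∑ i, ∑ j, d' i j)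
    (σ'2 : ℝ)
    (hσ'2 : σ'2 = 2 / (((n : ℝ) - 1) * ((n : ℝ) - 3)) *
      (((n : ℝ) - 2) * (∑ i, ∑ j, d' i j ^ 2) + tot' ^ 2 / ((n : ℝ) - 1)
        - 2 * ∑ i, (∑ j, d' i j) ^ 2))
    (dhat' : Fin n → Fin n → ℝ)
    (hdhat' : ∀ i j, dhat' i j = if i = j then 0 else
      d' i j - (∑ a, d' i a) / ((n : ℝ) - 2) - (∑ a, d' a j) / ((n : ℝ) - 2)
        + tot' / (((n : ℝ) - 1) * ((n : ℝ) - 2)))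
    (dtilde : Fin n → Fin n → ℝ)
    (hdtilde : ∀ i j, dtilde i j = dhat' i j / Real.sqrt σ'2) :
    ∀ i j, |dtilde i j| ≤ 1 := by
  have hN : (1000 : ℝ) ≤ n := by exact_mod_cast hn1000
  set N : ℝ := (n : ℝ)
  have hβ : βD = ∑ i, ∑ j, |d i j| ^ 3 := by
    rw [hβD]
    refine sum_congr rfl fun i _ => sum_congr rfl fun j _ => ?_
    split_ifs with h
    · rfl
    · rw [not_ne_iff.1 h, hdiag]
      simp
  have hsymm' : ∀ i j, d' i j = d' j i := fun i j => by rw [hd', hd', hsymm]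
  have hrow_le : ∀ i, |∑ j, d' i j| ≤ 4 * ∑ j, |d i j| ^ 3 := by
    intro i
    have h : ∑ j, d' i j = -∑ j, (d i j - d' i j) := by
      rw [sum_sub_distrib, hrow]
      ring
    rw [h, abs_neg, mul_sum]
    refine (abs_sum_le_sum_abs _ _).trans (sum_le_sum fun j _ => ?_)
    rw [hd']
    exact abs_sub_truncate_le_four_mul_abs_cube _
  have hsum_abs : ∑ i, |∑ j, d' i j| ≤ 2 * N / 45 := by
    have h : ∑ i, |∑ j, d' i j| ≤ 4 * βD := by
      rw [hβ, mul_sum]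
      exact sum_le_sum fun i _ => hrow_le i
    linarith
  have hr : ∀ i, |∑ j, d' i j| ≤ 2 * N / 45 := fun i =>
    (single_le_sum (f := fun i => |∑ j, d' i j|) (fun _ _ => abs_nonneg _)
      (mem_univ i)).trans hsum_abs
  have htot : |tot'| ≤ 2 * N / 45 := by
    rw [htot']
    exact (abs_sum_le_sum_abs _ _).trans hsum_abs
  have hsum_sq : ∑ i, (∑ j, d' i j) ^ 2 ≤ (2 * N / 45) ^ 2 := by
    calc ∑ i, (∑ j, d' i j) ^ 2 = ∑ i, |∑ j, d' i j| ^ 2 := by simp only [sq_abs]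
      _ ≤ (∑ i, |∑ j, d' i j|) ^ 2 := sum_sq_le_sq_sum_of_nonneg fun _ _ => abs_nonneg _
      _ ≤ _ := pow_le_pow_left₀ (sum_nonneg fun _ _ => abs_nonneg _) hsum_abs 2
  have hsq : (∑ i, ∑ j, d i j ^ 2) - N / 45 ≤ ∑ i, ∑ j, d' i j ^ 2 := by
    have h : (∑ i, ∑ j, d i j ^ 2) - 2 * βD ≤ ∑ i, ∑ j, d' i j ^ 2 := by
      rw [hβ, mul_sum, ← sum_sub_distrib]
      refine sum_le_sum fun i _ => ?_
      rw [mul_sum, ← sum_sub_distrib]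
      refine sum_le_sum fun j _ => ?_
      rw [hd']
      exact sq_sub_two_mul_abs_cube_le_sq_truncate _
    linarith
  have hY : 0 < (N - 1) * (N - 3) := mul_pos (by linarith) (by linarith)
  have hS : 2 * ((N - 2) * ∑ i, ∑ j, d i j ^ 2) = (N - 1) * (N - 3) := by
    rw [div_mul_eq_mul_div, div_eq_one_iff_eq hY.ne'] at hvar
    linarith
  have hσ : 1 / 2 ≤ σ'2 := by
    have h1 := mul_le_mul_of_nonneg_left hsq (by linarith : (0 : ℝ) ≤ N - 2)
    have h2 : 0 ≤ tot' ^ 2 / (N - 1) := div_nonneg (sq_nonneg _) (by linarith)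
    rw [hσ'2, div_mul_eq_mul_div, le_div_iff₀ hY]
    nlinarith
  intro i j
  rw [hdtilde, abs_div, abs_of_nonneg (Real.sqrt_nonneg _)]
  refine div_le_one_of_le₀ (Real.abs_le_sqrt ?_) (Real.sqrt_nonneg _)
  have hentry : |dhat' i j| ≤ 7 / 10 := by
    rw [hdhat']
    split_ifs with hij
    · norm_num
    · have hd'_le : |d' i j| ≤ 1 / 2 := by
        rw [hd']
        split_ifs with h
        · exact h
        · norm_num
      have hdiv : ∀ x : ℝ, |x| ≤ 2 * N / 45 → |x / (N - 2)| ≤ 1 / 20 := by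
        intro x hx
        rw [abs_div, abs_of_pos (by linarith : 0 < N - 2), div_le_iff₀ (by linarith)]
        linarith
      have hcol : ∑ a, d' a j = ∑ a, d' j a := sum_congr rfl fun a _ => hsymm' a j
      have h3 : |tot' / ((N - 1) * (N - 2))| ≤ 1 / 20 := by
        rw [mul_comm, ← div_div, abs_div, abs_of_pos (by linarith : 0 < N - 1)]
        exact (div_le_self (abs_nonneg _) (by linarith)).trans (hdiv _ htot)
      have h1 := hdiv _ (hr i)
      have h2 := hdiv _ (hr j)
      rw [hcol]
      rw [abs_le] at *
      constructor <;> linarith [h1.1, h1.2, h2.1, h2.2, h3.1, h3.2, hd'_le.1, hd'_le.2]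
  have := pow_le_pow_left₀ (abs_nonneg _) hentry 2
  rw [sq_abs] at this
  linarith
end
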